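/- arXiv:1308.4251 — 3 statements merged into one kernel-verified Lean document; each statement's English description precedes it below -/
import Mathlib

section
/- Let $G$ be a connected graph of order $n$. Then $rx_3(G) = n-1$ if and only if $G$ is a tree or $G$ is a unicyclic graph whose unique cycle has length 3. -/
open SimpleGraph

/-- An edge-coloring `c` is a `k`-rainbow coloring of `G` if every `k`-set of vertices
is contained in a rainbow tree: a subgraph of `G` that is a tree, contains the `k` vertices,
and whose edges receive pairwise distinct colors. -/
def IsRainbowColoring {V : Type*} [Fintype V] (G : SimpleGraph V) {α : Type*}
    (c : Sym2 V → α) (k : ℕ) : Prop :=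
  ∀ S : Finset V, S.card = k →
    ∃ T : G.Subgraph, (↑S : Set V) ⊆ T.verts ∧ T.coe.IsTree ∧ Set.InjOn c T.edgeSet

/-- The `k`-rainbow index of `G`: the minimum number of colors in a `k`-rainbow coloring. -/
noncomputable def rxk {V : Type*} [Fintype V] (G : SimpleGraph V) (k : ℕ) : ℕ :=
  sInf {q | ∃ c : Sym2 V → Fin q, IsRainbowColoring G c k}

namespace SimpleGraph

variable {V : Type*} {G : SimpleGraph V}

/-- A rooted spanning forest: any edge set `F₀` extends to one that links every vertex to `U`,
at the cost of one edge for each vertex outside `U`. -/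
lemma Connected.exists_edges_reachable_to [Fintype V] [DecidableEq V] (hG : G.Connected)
    (U : Finset V) (hU : U.Nonempty) (F₀ : Finset (Sym2 V)) (hF₀ : ↑F₀ ⊆ G.edgeSet) :
    ∃ F : Finset (Sym2 V), F₀ ⊆ F ∧ ↑F ⊆ G.edgeSet ∧ F.card + U.card ≤ F₀.card + Fintype.card V ∧
      ∀ v, ∃ u ∈ U, (fromEdgeSet (F : Set (Sym2 V))).Reachable v u := by
  induction h : Fintype.card V - U.card generalizing U F₀ with
  | zero =>
    have hU' : U = Finset.univ := by
      rw [← Finset.card_eq_iff_eq_univ]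
      have := Finset.card_le_univ U
      omega
    refine ⟨F₀, subset_rfl, hF₀, ?_, fun v => ⟨v, by simp [hU'], .rfl⟩⟩
    have := Finset.card_le_univ U
    omega
  | succ k ih =>
    obtain ⟨r, hr⟩ := hU
    obtain ⟨s, hs⟩ : ∃ s, s ∉ U := by
      by_contra! hall
      rw [Finset.eq_univ_iff_forall.2 hall, Finset.card_univ] at h
      omega
    obtain ⟨p⟩ := hG.preconnected r s
    obtain ⟨⟨⟨u, v⟩, huv⟩, -, hu, hv⟩ := p.exists_boundary_dart U hr hs
    simp only [Finset.mem_coe] at hu hv huv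
    have hcard := Finset.card_insert_of_notMem hv
    obtain ⟨F, hF₁, hF₂, hF₃, hF₄⟩ := ih (insert v U) (Finset.insert_nonempty _ _)
      (insert s(u, v) F₀) (by simp [Set.insert_subset_iff, hF₀, huv]) (by omega)
    refine ⟨F, (Finset.subset_insert _ _).trans hF₁, hF₂, ?_, fun w => ?_⟩
    · have := Finset.card_insert_le s(u, v) F₀
      omega
    · obtain ⟨x, hx, hwx⟩ := hF₄ w
      rcases Finset.mem_insert.1 hx with rfl | hx
      · refine ⟨u, hu, hwx.trans (Adj.reachable ?_)⟩
        rw [fromEdgeSet_adj, Sym2.eq_swap]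
        exact ⟨hF₁ (Finset.mem_insert_self _ _), huv.ne'⟩
      · exact ⟨x, hx, hwx⟩

/-- A component of a subgraph on an edge set contains a tree with the same vertices. -/
lemma exists_tree_of_reachable (E : Set (Sym2 V)) (hE : E ⊆ G.edgeSet) (t : V) :
    ∃ T : G.Subgraph, T.verts = {v | (fromEdgeSet E).Reachable v t} ∧ T.coe.IsTree ∧
      T.edgeSet ⊆ E := by
  set C := (fromEdgeSet E).connectedComponentMk t with hC
  obtain ⟨T₀, hT₀, hT₀'⟩ := C.connected_toSimpleGraph.exists_isTree_le
  have hadj : ∀ {a b : C}, T₀.Adj a b → s(a.1, b.1) ∈ E := fun h =>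
    ((fromEdgeSet_adj _).1 (hT₀ h)).1
  let T : G.Subgraph :=
    { verts := C.supp
      Adj := fun a b => ∃ (ha : a ∈ C.supp) (hb : b ∈ C.supp), T₀.Adj ⟨a, ha⟩ ⟨b, hb⟩
      adj_sub := fun ⟨_, _, h⟩ => hE (hadj h)
      edge_vert := fun ⟨ha, _, _⟩ => ha
      symm := ⟨fun _ _ ⟨ha, hb, h⟩ => ⟨hb, ha, h.symm⟩⟩ }
  have hT : T.coe = T₀ := by
    ext a b
    exact ⟨fun ⟨_, _, h⟩ => h, fun h => ⟨a.2, b.2, h⟩⟩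
  refine ⟨T, ?_, hT ▸ hT₀', ?_⟩
  · ext v
    simp [T, hC]
  · rintro ⟨a, b⟩ ⟨_, _, h⟩
    exact hadj h

/-- Colour the edges of `F` with private colours and all other edges by `g`. -/
lemma exists_isRainbowColoring_of_edges [Fintype V] (F : Finset (Sym2 V)) (hF : ↑F ⊆ G.edgeSet)
    {m k N : ℕ} (g : Sym2 V → Fin m) (hN : F.card + m ≤ N)
    (h : ∀ S : Finset V, S.card = k → ∃ D : Set (Sym2 V), D ⊆ G.edgeSet ∧ Set.InjOn g D ∧
      ∃ t, ∀ v ∈ S, (fromEdgeSet (↑F ∪ D)).Reachable v t) :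
    ∃ c : Sym2 V → Fin N, IsRainbowColoring G c k := by
  classical
  have hcard : Fintype.card (F ⊕ Fin m) ≤ Fintype.card (Fin N) := by simpa using hN
  obtain ⟨ι⟩ := Function.Embedding.nonempty_of_card_le hcard
  refine ⟨fun e => ι (if he : e ∈ F then .inl ⟨e, he⟩ else .inr (g e)), fun S hS => ?_⟩
  obtain ⟨D, hD, hinj, t, ht⟩ := h S hS
  obtain ⟨T, hv, hT, hTE⟩ := exists_tree_of_reachable (↑F ∪ D) (Set.union_subset hF hD) t
  refine ⟨T, fun v hvS => hv ▸ ht v hvS, hT, ?_⟩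
  intro e he f hf hef
  have he' := hTE he
  have hf' := hTE hf
  have := ι.injective hef
  by_cases h₁ : e ∈ F <;> by_cases h₂ : f ∈ F <;> simp only [h₁, h₂, dite_true, dite_false,
    Sum.inl.injEq, Sum.inr.injEq, Subtype.mk.injEq, reduceCtorEq] at this
  · exact this
  · exact hinj (he'.resolve_left h₁) (hf'.resolve_left h₂) this

lemma Connected.exists_isRainbowColoring [Fintype V] (hG : G.Connected)
    (hn : 2 ≤ Fintype.card V) (k : ℕ) :
    ∃ c : Sym2 V → Fin (Fintype.card V - 1), IsRainbowColoring G c k := by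
  classical
  obtain ⟨r⟩ := hG.nonempty
  obtain ⟨F, -, hF, hcard, hreach⟩ :=
    hG.exists_edges_reachable_to {r} (Finset.singleton_nonempty _) ∅ (by simp)
  simp only [Finset.card_singleton, Finset.card_empty, Finset.mem_singleton, exists_eq_left]
    at hcard hreach
  rcases F.eq_empty_or_nonempty with rfl | ⟨e, he⟩
  · refine exists_isRainbowColoring_of_edges ∅ (by simp) (fun _ => (0 : Fin 1)) (by simp; omega) ?_
    exact fun S _ => ⟨∅, by simp, by simp, r, fun v _ => by simpa using hreach v⟩
  · have := Finset.card_erase_add_one he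
    refine exists_isRainbowColoring_of_edges (F.erase e) (fun f hf => hF (Finset.mem_of_mem_erase hf))
      (fun _ => (0 : Fin 1)) (by omega) ?_
    refine fun S _ => ⟨{e}, by simpa using hF he, by simp, r, fun v _ => ?_⟩
    have hE : (↑(F.erase e) ∪ {e} : Set (Sym2 V)) = F := by
      simpa using he
    rw [hE]
    exact hreach v

/-- The forest grown from a path together with the isolated roots `R`: every vertex is linked
to a vertex of `R` or to the start of the path. -/
lemma Connected.exists_edges_of_isPath [Fintype V] [DecidableEq V] (hG : G.Connected)
    {p q : V} (w : G.Walk p q) (hw : w.IsPath) (R : Finset V) (hR : ∀ v ∈ R, v ∉ w.support) :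
    ∃ F : Finset (Sym2 V), ↑F ⊆ G.edgeSet ∧ F.card + R.card + 1 ≤ Fintype.card V ∧
      (fromEdgeSet (F : Set (Sym2 V))).Reachable q p ∧
      ∀ v, ∃ u ∈ insert p R, (fromEdgeSet (F : Set (Sym2 V))).Reachable v u := by
  obtain ⟨F, hF₀, hF, hcard, hreach⟩ := hG.exists_edges_reachable_to (w.support.toFinset ∪ R)
    ⟨p, by simp⟩ w.edges.toFinset (fun e he => w.edges_subset_edgeSet (by simpa using he))
  have hsupp : ∀ u ∈ w.support, (fromEdgeSet (F : Set (Sym2 V))).Reachable u p := by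
    intro u hu
    refine Reachable.symm ⟨(w.takeUntil u hu).transfer _ fun e he => ?_⟩
    have he' := w.edges_takeUntil_subset_edges hu he
    rw [edgeSet_fromEdgeSet]
    exact ⟨hF₀ (by simpa using he'), G.not_isDiag_of_mem_edgeSet (w.edges_subset_edgeSet he')⟩
  refine ⟨F, hF, ?_, hsupp q w.end_mem_support, fun v => ?_⟩
  · rw [Finset.card_union_of_disjoint (Finset.disjoint_left.2 fun v hv hvR =>
      hR v hvR (by simpa using hv)), List.toFinset_card_of_nodup hw.support_nodup,
      List.toFinset_card_of_nodup hw.isTrail.edges_nodup, Walk.length_support,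
      Walk.length_edges] at hcard
    omega
  · obtain ⟨u, hu, hvu⟩ := hreach v
    rcases Finset.mem_union.1 hu with hu | hu
    · exact ⟨p, by simp, hvu.trans (hsupp u (by simpa using hu))⟩
    · exact ⟨u, by simp [hu], hvu⟩

lemma reachable_fromEdgeSet_of_mem {E : Set (Sym2 V)} {u v : V} (h : s(u, v) ∈ E) :
    (fromEdgeSet E).Reachable u v := by
  by_cases huv : u = v
  · exact huv ▸ .rfl
  · exact Adj.reachable ((fromEdgeSet_adj _).2 ⟨h, huv⟩)

/-- If the forest `F` links every vertex to a root in `R'`, a set of three vertices misses one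
of any four roots, so it suffices to connect the remaining roots by a rainbow edge set. -/
lemma rxk_three_le_of_roots [Fintype V] (F : Finset (Sym2 V)) (hF : ↑F ⊆ G.edgeSet)
    {m N : ℕ} (g : Sym2 V → Fin m) (hN : F.card + m ≤ N) (R R' : Finset V) (hR : 4 ≤ R.card)
    (hreach : ∀ v, ∃ u ∈ R', (fromEdgeSet (F : Set (Sym2 V))).Reachable v u)
    (h : ∀ r ∈ R, ∃ D : Set (Sym2 V), D ⊆ G.edgeSet ∧ Set.InjOn g D ∧
      ∃ t, ∀ u ∈ R', u ≠ r → (fromEdgeSet (↑F ∪ D)).Reachable u t) :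
    rxk G 3 ≤ N := by
  classical
  refine Nat.sInf_le (exists_isRainbowColoring_of_edges F hF g hN fun S hS => ?_)
  choose ρ hρ hρ' using hreach
  have hlt : (S.image ρ).card < R.card := by
    have := Finset.card_image_le (s := S) (f := ρ)
    omega
  obtain ⟨r, hr, hr'⟩ := Finset.exists_mem_notMem_of_card_lt_card hlt
  obtain ⟨D, hD, hg, t, ht⟩ := h r hr
  refine ⟨D, hD, hg, t, fun v hv => ((hρ' v).mono (fromEdgeSet_mono Set.subset_union_left)).trans
    (ht (ρ v) (hρ v) fun h => hr' (h ▸ Finset.mem_image_of_mem ρ hv))⟩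

/-- A cycle of length at least four, given as `y - x - z` closed up by a path from `p` to `q`. -/
lemma Connected.rxk_three_le_of_long_cycle [Fintype V] (hG : G.Connected) {x y z p q : V}
    (hxy : G.Adj x y) (hxz : G.Adj x z) (hyz : y ≠ z) (hyp : G.Adj y p) (hzq : G.Adj z q)
    (w : G.Walk p q) (hw : w.IsPath) (hx : x ∉ w.support) (hy : y ∉ w.support)
    (hz : z ∉ w.support) : rxk G 3 ≤ Fintype.card V - 2 := by
  classical
  have hxp : x ≠ p := fun h => hx (h ▸ w.start_mem_support)
  have hxq : x ≠ q := fun h => hx (h ▸ w.end_mem_support)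
  have hyq : y ≠ q := fun h => hy (h ▸ w.end_mem_support)
  have hzp : z ≠ p := fun h => hz (h ▸ w.start_mem_support)
  have hR : ({x, y, z} : Finset V).card = 3 :=
    Finset.card_eq_three.2 ⟨x, y, z, hxy.ne, hxz.ne, hyz, rfl⟩
  obtain ⟨F, hF, hcard, hqp, hreach⟩ := hG.exists_edges_of_isPath w hw {x, y, z}
    (by simp [hx, hy, hz])
  have hR' : (insert p {x, y, z} : Finset V).card = 4 := by
    rw [Finset.card_insert_of_notMem (by simp [hxp.symm, hyp.ne', hzp.symm]), hR]
  let g : Sym2 V → Fin 2 := fun e => if e = s(x, y) ∨ e = s(z, q) then 0 else 1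
  have g₁ : g s(x, y) = 0 := by simp [g]
  have g₂ : g s(z, q) = 0 := by simp [g]
  have g₃ : g s(y, p) = 1 := by
    simp [g, hxp.symm, hxy.ne', hyz, hyq]
  have g₄ : g s(x, z) = 1 := by
    simp [g, hxz.ne, hxy.ne, hyz.symm, hxq]
  have hinj : ∀ e f, g e = 0 → g f = 1 → Set.InjOn g {e, f} := by
    rintro e f he hf _ (rfl | rfl) _ (rfl | rfl) h <;> simp_all
  have hqp' (D : Set (Sym2 V)) : (fromEdgeSet (F ∪ D)).Reachable q p :=
    hqp.mono (fromEdgeSet_mono Set.subset_union_left)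
  have hD {D : Set (Sym2 V)} {a b : V} (h : s(a, b) ∈ D) : (fromEdgeSet (F ∪ D)).Reachable a b :=
    reachable_fromEdgeSet_of_mem (Or.inr h)
  refine rxk_three_le_of_roots F hF g (by omega) _ _ hR'.ge hreach ?_
  simp only [Finset.mem_insert, Finset.mem_singleton, forall_eq_or_imp, forall_eq]
  refine ⟨⟨{s(x, y), s(x, z)}, by simp [Set.insert_subset_iff, hxy, hxz], hinj _ _ g₁ g₄, x, ?_⟩,
    ⟨{s(z, q), s(y, p)}, by simp [Set.insert_subset_iff, hyp, hzq], hinj _ _ g₂ g₃, p, ?_⟩,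
    ⟨{s(z, q), s(x, z)}, by simp [Set.insert_subset_iff, hxz, hzq], hinj _ _ g₂ g₄, p, ?_⟩,
    ⟨{s(x, y), s(y, p)}, by simp [Set.insert_subset_iff, hxy, hyp], hinj _ _ g₁ g₃, p, ?_⟩⟩
  · exact ⟨fun h => absurd rfl h, fun _ => .rfl, fun _ => (hD (by simp)).symm,
      fun _ => (hD (by simp)).symm⟩
  · exact ⟨fun _ => .rfl, fun h => absurd rfl h, fun _ => hD (by simp),
      fun _ => (hD (by simp)).trans (hqp' _)⟩
  · have hz' := (hD (D := {s(z, q), s(x, z)}) (a := z) (b := q) (by simp)).trans (hqp' _)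
    exact ⟨fun _ => .rfl, fun _ => (hD (by simp)).trans hz', fun h => absurd rfl h, fun _ => hz'⟩
  · have hy' := hD (D := {s(x, y), s(y, p)}) (a := y) (b := p) (by simp)
    exact ⟨fun _ => .rfl, fun _ => (hD (by simp)).trans hy', fun _ => hy', fun h => absurd rfl h⟩

/-- Two triangles `p a b` and `q c d` joined by a path from `p` to `q`. -/
lemma Connected.rxk_three_le_of_two_triangles [Fintype V] (hG : G.Connected) {a b c d p q : V}
    (hab : G.Adj a b) (hap : G.Adj a p) (hbp : G.Adj b p)
    (hcd : G.Adj c d) (hcq : G.Adj c q) (hdq : G.Adj d q)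
    (hac : a ≠ c) (had : a ≠ d) (hbc : b ≠ c) (hbd : b ≠ d)
    (w : G.Walk p q) (hw : w.IsPath) (ha : a ∉ w.support) (hb : b ∉ w.support)
    (hc : c ∉ w.support) (hd : d ∉ w.support) : rxk G 3 ≤ Fintype.card V - 2 := by
  classical
  have haq : a ≠ q := fun h => ha (h ▸ w.end_mem_support)
  have hbq : b ≠ q := fun h => hb (h ▸ w.end_mem_support)
  have hcp : c ≠ p := fun h => hc (h ▸ w.start_mem_support)
  have hdp : d ≠ p := fun h => hd (h ▸ w.start_mem_support)
  have hR : ({a, b, c, d} : Finset V).card = 4 := by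
    rw [Finset.card_insert_of_notMem (by simp [hab.ne, hac, had]),
      Finset.card_eq_three.2 ⟨b, c, d, hbc, hbd, hcd.ne, rfl⟩]
  obtain ⟨F, hF, hcard, hqp, hreach⟩ := hG.exists_edges_of_isPath w hw {a, b, c, d}
    (by simp [ha, hb, hc, hd])
  let g : Sym2 V → Fin 3 := fun e =>
    if e = s(a, p) ∨ e = s(c, q) then 0 else if e = s(b, p) ∨ e = s(d, q) then 1 else 2
  have g₁ : g s(a, p) = 0 := by simp [g]
  have g₂ : g s(c, q) = 0 := by simp [g]
  have g₃ : g s(b, p) = 1 := by simp [g, hab.ne', hbp.ne, hbc, hbq]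
  have g₄ : g s(d, q) = 1 := by simp [g, hcd.ne', hdq.ne, hdp, had.symm]
  have g₅ : g s(a, b) = 2 := by simp [g, hab.ne, hab.ne', hap.ne, hbp.ne, hac, had, haq, hbq]
  have g₆ : g s(c, d) = 2 := by
    simp [g, hcd.ne, hcd.ne', hcq.ne, hdq.ne, hac.symm, hbc.symm, hcp, hdp]
  have hinj : ∀ e f k, g e = 0 → g f = 1 → g k = 2 → Set.InjOn g {e, f, k} := by
    rintro e f k he hf hk _ (rfl | rfl | rfl) _ (rfl | rfl | rfl) h <;> simp_all
  have hqp' (D : Set (Sym2 V)) : (fromEdgeSet (F ∪ D)).Reachable q p :=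
    hqp.mono (fromEdgeSet_mono Set.subset_union_left)
  have hD {D : Set (Sym2 V)} {a b : V} (h : s(a, b) ∈ D) : (fromEdgeSet (F ∪ D)).Reachable a b :=
    reachable_fromEdgeSet_of_mem (Or.inr h)
  refine rxk_three_le_of_roots F hF g (by omega) {a, b, c, d} _ hR.ge hreach ?_
  simp only [Finset.mem_insert, Finset.mem_singleton, forall_eq_or_imp, forall_eq]
  refine ⟨⟨{s(c, q), s(b, p), s(c, d)}, by simp [Set.insert_subset_iff, *],
      hinj _ _ _ g₂ g₃ g₆, p, ?_⟩,
    ⟨{s(a, p), s(d, q), s(c, d)}, by simp [Set.insert_subset_iff, *],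
      hinj _ _ _ g₁ g₄ g₆, p, ?_⟩,
    ⟨{s(a, p), s(d, q), s(a, b)}, by simp [Set.insert_subset_iff, *],
      hinj _ _ _ g₁ g₄ g₅, p, ?_⟩,
    ⟨{s(c, q), s(b, p), s(a, b)}, by simp [Set.insert_subset_iff, *],
      hinj _ _ _ g₂ g₃ g₅, p, ?_⟩⟩
  · have hc' := (hD (D := {s(c, q), s(b, p), s(c, d)}) (a := c) (b := q) (by simp)).trans (hqp' _)
    exact ⟨fun _ => .rfl, fun h => absurd rfl h, fun _ => hD (by simp), fun _ => hc',
      fun _ => (hD (by simp)).symm.trans hc'⟩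
  · have hd' := (hD (D := {s(a, p), s(d, q), s(c, d)}) (a := d) (b := q) (by simp)).trans (hqp' _)
    exact ⟨fun _ => .rfl, fun _ => hD (by simp), fun h => absurd rfl h,
      fun _ => (hD (by simp)).trans hd', fun _ => hd'⟩
  · have ha' := hD (D := {s(a, p), s(d, q), s(a, b)}) (a := a) (b := p) (by simp)
    exact ⟨fun _ => .rfl, fun _ => ha', fun _ => (hD (by simp)).symm.trans ha',
      fun h => absurd rfl h, fun _ => (hD (by simp)).trans (hqp' _)⟩
  · have hb' := hD (D := {s(c, q), s(b, p), s(a, b)}) (a := b) (b := p) (by simp)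
    exact ⟨fun _ => .rfl, fun _ => (hD (by simp)).trans hb', fun _ => hb',
      fun _ => (hD (by simp)).trans (hqp' _), fun h => absurd rfl h⟩

lemma Connected.rxk_three_le_of_isCycle [Fintype V] (hG : G.Connected) {x : V} (c : G.Walk x x)
    (hc : c.IsCycle) (hlen : 4 ≤ c.length) : rxk G 3 ≤ Fintype.card V - 2 := by
  cases c with
  | nil => simp at hlen
  | @cons _ y _ hxy w =>
  rw [Walk.cons_isCycle_iff] at hc
  have hrev := hc.1.reverse
  have hl : 3 ≤ w.reverse.length := by
    simp only [Walk.length_cons, Walk.length_reverse] at hlen ⊢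
    omega
  generalize w.reverse = v at hrev hl
  cases v with
  | nil => simp at hl
  | @cons _ z _ hxz v =>
  cases v with
  | nil => simp at hl
  | @cons _ q _ hzq v =>
  rw [Walk.cons_isPath_iff, Walk.cons_isPath_iff] at hrev
  obtain ⟨⟨hv, hz⟩, hx⟩ := hrev
  have hrev := hv.reverse
  have hl : 1 ≤ v.reverse.length := by
    simp only [Walk.length_cons, Walk.length_reverse] at hl ⊢
    omega
  have hz' : z ∉ v.reverse.support := by simpa using hz
  have hx' : x ∉ v.reverse.support := by
    simp only [Walk.support_cons, List.mem_cons, not_or] at hx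
    simpa using hx.2
  generalize v.reverse = t at hrev hl hx' hz'
  cases t with
  | nil => simp at hl
  | @cons _ p _ hyp t =>
  rw [Walk.cons_isPath_iff] at hrev
  simp only [Walk.support_cons, List.mem_cons, not_or] at hx' hz'
  exact hG.rxk_three_le_of_long_cycle hxy hxz (fun h => hz'.1 h.symm) hyp hzq t hrev.1 hx'.2
    hrev.2 hz'.2

lemma Walk.exists_triangle_of_length_eq_three {x : V} (c : G.Walk x x) (hc : c.length = 3) :
    ∃ a b, G.Adj x a ∧ G.Adj a b ∧ G.Adj b x := by
  have h₀ := c.adj_getVert_succ (i := 0) (by omega)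
  have h₁ := c.adj_getVert_succ (i := 1) (by omega)
  have h₂ := c.adj_getVert_succ (i := 2) (by omega)
  have h₃ : c.getVert 3 = x := hc ▸ c.getVert_length
  simp only [Walk.getVert_zero, Nat.reduceAdd, zero_add, h₃] at h₀ h₁ h₂
  exact ⟨_, _, h₀, h₁, h₂⟩

/-- A shortest walk between two sets meets each of them only in an end. -/
lemma Connected.exists_isPath_between (hG : G.Connected) (X Y : Set V) (hX : X.Nonempty)
    (hY : Y.Nonempty) :
    ∃ p ∈ X, ∃ q ∈ Y, ∃ w : G.Walk p q, w.IsPath ∧ (∀ v ∈ w.support, v ∈ X → v = p) ∧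
      (∀ v ∈ w.support, v ∈ Y → v = q) ∧ ((X ∩ Y).Nonempty → p = q) := by
  classical
  have hex : ∃ n, ∃ p ∈ X, ∃ q ∈ Y, ∃ w : G.Walk p q, w.length = n := by
    obtain ⟨p, hp⟩ := hX
    obtain ⟨q, hq⟩ := hY
    obtain ⟨w⟩ := hG.preconnected p q
    exact ⟨_, p, hp, q, hq, w, rfl⟩
  obtain ⟨p, hp, q, hq, w, hw⟩ := Nat.find_spec hex
  have hmin : ∀ {p' q'}, p' ∈ X → q' ∈ Y → ∀ w' : G.Walk p' q', w.length ≤ w'.length :=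
    fun hp' hq' w' => hw ▸ Nat.find_min' hex ⟨_, hp', _, hq', w', rfl⟩
  refine ⟨p, hp, q, hq, w, ?_, fun v hv hvX => ?_, fun v hv hvY => ?_, ?_⟩
  · refine w.isPath_of_length_eq_dist (le_antisymm ?_ (dist_le w))
    obtain ⟨w', hw'⟩ := (hG.preconnected p q).exists_walk_length_eq_dist
    exact hw' ▸ hmin hp hq w'
  · have h := hmin hvX hq (w.dropUntil v hv)
    have h' := congrArg Walk.length (w.take_spec hv)
    rw [Walk.length_append] at h'
    exact (Walk.eq_of_length_eq_zero (p := w.takeUntil v hv) (by omega)).symm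
  · have h := hmin hp hvY (w.takeUntil v hv)
    have h' := congrArg Walk.length (w.take_spec hv)
    rw [Walk.length_append] at h'
    exact Walk.eq_of_length_eq_zero (p := w.dropUntil v hv) (by omega)
  · rintro ⟨v, hvX, hvY⟩
    have h := hmin hvX hvY .nil
    exact Walk.eq_of_length_eq_zero (p := w) (by simpa using h)

lemma IsClique.exists_three_of_mem {X : Set V} (hX : G.IsClique X) (hcard : X.ncard = 3) {p : V}
    (hp : p ∈ X) : ∃ a b, X = {p, a, b} ∧ G.Adj a b ∧ G.Adj a p ∧ G.Adj b p := by
  obtain ⟨a, b, hab, h⟩ : ∃ a b, a ≠ b ∧ X \ {p} = {a, b} := by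
    rw [← Set.ncard_eq_two, Set.ncard_sdiff_singleton_of_mem hp, hcard]
  have hX' : X = {p, a, b} := by
    rw [← h, Set.insert_sdiff_singleton, Set.insert_eq_of_mem hp]
  have ha : a ∈ X \ {p} := by simp [h]
  have hb : b ∈ X \ {p} := by simp [h]
  exact ⟨a, b, hX', hX ha.1 hb.1 hab, hX ha.1 hp ha.2, hX hb.1 hp hb.2⟩

lemma Connected.rxk_three_le_of_isClique [Fintype V] (hG : G.Connected) {X Y : Set V}
    (hX : G.IsClique X) (hXc : X.ncard = 3) (hY : G.IsClique Y) (hYc : Y.ncard = 3)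
    (hXY : X ≠ Y) : rxk G 3 ≤ Fintype.card V - 2 := by
  obtain ⟨p, hp, q, hq, w, hw, hwX, hwY, hpq⟩ := hG.exists_isPath_between X Y
    (Set.nonempty_of_ncard_ne_zero (by omega)) (Set.nonempty_of_ncard_ne_zero (by omega))
  obtain ⟨a, b, rfl, hab, hap, hbp⟩ := hX.exists_three_of_mem hXc hp
  obtain ⟨c, d, rfl, hcd, hcq, hdq⟩ := hY.exists_three_of_mem hYc hq
  have ha : a ∉ w.support := fun h => hap.ne (hwX a h (by simp))
  have hb : b ∉ w.support := fun h => hbp.ne (hwX b h (by simp))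
  have hc : c ∉ w.support := fun h => hcq.ne (hwY c h (by simp))
  have hd : d ∉ w.support := fun h => hdq.ne (hwY d h (by simp))
  have common : ∀ {p a b d : V}, G.Adj a b → G.Adj a p → G.Adj b p → G.Adj a d → G.Adj d p →
      b ≠ d → rxk G 3 ≤ Fintype.card V - 2 := fun hab hap hbp had hdp hbd =>
    hG.rxk_three_le_of_long_cycle hab had hbd hbp hdp .nil .nil (by simpa using hap.ne)
      (by simpa using hbp.ne) (by simpa using hdp.ne)
  by_cases hac : a = c
  · obtain rfl := hpq ⟨a, by simp, by simp [hac]⟩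
    subst hac
    exact common hab hap hbp hcd hdq (by rintro rfl; exact hXY rfl)
  by_cases had : a = d
  · obtain rfl := hpq ⟨a, by simp, by simp [had]⟩
    subst had
    exact common hab hap hbp hcd.symm hcq (by rintro rfl; exact hXY (by rw [Set.pair_comm]))
  by_cases hbc : b = c
  · obtain rfl := hpq ⟨b, by simp, by simp [hbc]⟩
    subst hbc
    exact common hab.symm hbp hap hcd hdq had
  by_cases hbd : b = d
  · obtain rfl := hpq ⟨b, by simp, by simp [hbd]⟩
    subst hbd
    exact common hab.symm hbp hap hcd.symm hcq hac
  exact hG.rxk_three_le_of_two_triangles hab hap hbp hcd hcq hdq hac had hbc hbd w hw ha hb hc hd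

lemma isClique_triple {a b c : V} (hab : G.Adj a b) (hbc : G.Adj b c) (hca : G.Adj c a) :
    G.IsClique {a, b, c} ∧ ({a, b, c} : Set V).ncard = 3 :=
  ⟨by simp [isClique_insert, hab, hbc, hca.symm],
    Set.ncard_eq_three.2 ⟨a, b, c, hab.ne, hca.ne', hbc.ne, rfl⟩⟩

lemma connected_deleteEdges_of_triangle (hG : G.Connected) {a b c : V}
    (hbc : G.Adj b c) (hca : G.Adj c a) : (G.deleteEdges {s(a, b)}).Connected := by
  refine hG.connected_delete_edge_of_not_isBridge fun h => h ?_
  have h₁ : (G.deleteEdges {s(a, b)}).Adj a c := by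
    simp [hca.symm, hbc.ne', hca.ne]
  have h₂ : (G.deleteEdges {s(a, b)}).Adj c b := by
    simp [hbc.symm, hbc.ne', hca.ne]
  exact h₁.reachable.trans h₂.reachable

lemma ncard_edgeSet_deleteEdges_singleton [Finite V] {e : Sym2 V} (he : e ∈ G.edgeSet) :
    (G.deleteEdges {e}).edgeSet.ncard + 1 = G.edgeSet.ncard := by
  rw [edgeSet_deleteEdges]
  exact Set.ncard_sdiff_singleton_add_one he

lemma Connected.rxk_three_le_card_sub_two [Fintype V] (hG : G.Connected) (hT : ¬ G.IsTree)
    (hU : ¬ (G.edgeSet.ncard = Fintype.card V ∧ G.girth = 3)) :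
    rxk G 3 ≤ Fintype.card V - 2 := by
  by_cases hlong : ∃ (x : V) (c : G.Walk x x), c.IsCycle ∧ 4 ≤ c.length
  · obtain ⟨x, c, hc, hlen⟩ := hlong
    exact hG.rxk_three_le_of_isCycle c hc hlen
  push Not at hlong
  have hthree : ∀ {x} {c : G.Walk x x}, c.IsCycle → c.length = 3 := fun hc =>
    le_antisymm (Nat.le_of_lt_succ (hlong _ _ hc)) hc.three_le_length
  have hacyc : ¬ G.IsAcyclic := fun h => hT ⟨hG, h⟩
  obtain ⟨x, c, hc, hgirth⟩ := exists_girth_eq_length.2 hacyc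
  rw [hthree hc] at hgirth
  obtain ⟨a, b, hxa, hab, hbx⟩ := c.exists_triangle_of_length_eq_three (hthree hc)
  have hcon := connected_deleteEdges_of_triangle hG hab hbx
  have hncard := ncard_edgeSet_deleteEdges_singleton (G := G) (e := s(x, a)) hxa
  have hT' : ¬ (G.deleteEdges {s(x, a)}).IsTree := by
    rw [isTree_iff_connected_and_card]
    rintro ⟨-, h⟩
    rw [Nat.card_coe_set_eq, Nat.card_eq_fintype_card] at h
    exact hU ⟨by omega, hgirth⟩
  obtain ⟨y, c', hc'⟩ : ∃ (y : V) (c' : (G.deleteEdges {s(x, a)}).Walk y y), c'.IsCycle := by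
    by_contra! h
    exact hT' ⟨hcon, h⟩
  have hlen : c'.length = 3 := by
    simpa using hthree (hc'.mapLe (deleteEdges_le _))
  obtain ⟨a', b', h₁, h₂, h₃⟩ := c'.exists_triangle_of_length_eq_three hlen
  obtain ⟨hX, hXc⟩ := isClique_triple hxa hab hbx
  obtain ⟨hY, hYc⟩ := isClique_triple h₁ h₂ h₃
  refine hG.rxk_three_le_of_isClique hX hXc (hY.mono (deleteEdges_le _)) hYc fun h => ?_
  have := hY (h ▸ by simp : x ∈ _) (h ▸ by simp : a ∈ _) hxa.ne
  simp at this

/-- `e` is the only edge of `G` along which `σ` may change. -/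
def ChangesOnlyAt (G : SimpleGraph V) (e : Sym2 V) (σ : V → Prop) : Prop :=
  ∀ ⦃x y⦄, G.Adj x y → s(x, y) ≠ e → (σ x ↔ σ y)

lemma IsBridge.exists_changesOnlyAt {u v : V} (h : G.IsBridge s(u, v)) :
    ∃ σ : V → Prop, G.ChangesOnlyAt s(u, v) σ ∧ σ u ∧ ¬ σ v := by
  refine ⟨fun w => (G.deleteEdges {s(u, v)}).Reachable w u, fun x y hxy hne => ?_, .rfl,
    fun hr => h hr.symm⟩
  have : (G.deleteEdges {s(u, v)}).Adj x y := (deleteEdges_adj).2 ⟨hxy, hne⟩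
  exact ⟨this.symm.reachable.trans, this.reachable.trans⟩

lemma Subgraph.exists_adj_ne {T : G.Subgraph} (hT : T.coe.Connected) {β : Type*} (f : V → β)
    {x y : V} (hx : x ∈ T.verts) (hy : y ∈ T.verts) (hxy : f x ≠ f y) :
    ∃ u v, T.Adj u v ∧ f u = f x ∧ f v ≠ f x := by
  obtain ⟨p⟩ := hT.preconnected ⟨x, hx⟩ ⟨y, hy⟩
  obtain ⟨d, -, h₁, h₂⟩ := p.exists_boundary_dart {z | f z = f x} rfl hxy.symm
  exact ⟨_, _, d.adj, h₁, h₂⟩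

lemma ChangesOnlyAt.mem_edgeSet {e : Sym2 V} {σ : V → Prop} (h : G.ChangesOnlyAt e σ)
    {T : G.Subgraph} (hT : T.coe.Connected) {x y : V} (hx : x ∈ T.verts) (hy : y ∈ T.verts)
    (hσx : σ x) (hσy : ¬ σ y) : e ∈ T.edgeSet := by
  obtain ⟨u, v, huv, hu, hv⟩ := T.exists_adj_ne hT σ hx hy (by simp [hσx, hσy])
  by_cases he : s(u, v) = e
  · exact he ▸ huv
  · exact absurd ((propext (h huv.adj_sub he)).symm.trans hu) hv

lemma _root_.IsRainbowColoring.exists_tree [Fintype V] {α : Type*} {c : Sym2 V → α}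
    (hc : IsRainbowColoring G c 3) (hn : 3 ≤ Fintype.card V) (x y z : V) :
    ∃ T : G.Subgraph, x ∈ T.verts ∧ y ∈ T.verts ∧ z ∈ T.verts ∧ T.coe.Connected ∧
      Set.InjOn c T.edgeSet := by
  classical
  obtain ⟨S, hS, hcard⟩ := Finset.exists_superset_card_eq
    (Finset.card_le_three (a := x) (b := y) (c := z)) hn
  obtain ⟨T, hST, hT, hinj⟩ := hc S hcard
  exact ⟨T, hST (hS (by simp)), hST (hS (by simp)), hST (hS (by simp)), hT.connected, hinj⟩

lemma _root_.IsRainbowColoring.ne_of_changesOnlyAt [Fintype V] {α : Type*} {c : Sym2 V → α}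
    (hc : IsRainbowColoring G c 3) (hn : 3 ≤ Fintype.card V) {u v u' v' : V}
    {σ τ : V → Prop} (huv : G.Adj u v) (huv' : G.Adj u' v') (hne : s(u, v) ≠ s(u', v'))
    (hσ : G.ChangesOnlyAt s(u, v) σ) (hσuv : σ u ↔ ¬ σ v)
    (hτ : G.ChangesOnlyAt s(u', v') τ) (hτuv : τ u' ↔ ¬ τ v') :
    c s(u, v) ≠ c s(u', v') := by
  have h₁ := hσ huv' hne.symm
  have h₂ := hτ huv hne
  obtain ⟨s, hs⟩ : ∃ s, (σ s ↔ ¬ σ u') ∧ (τ s ↔ τ u) := by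
    by_cases h : σ u' ↔ σ u
    · exact ⟨v, by grind, by grind⟩
    · exact ⟨u, by grind, by grind⟩
  obtain ⟨t, ht⟩ : ∃ t, (τ t ↔ ¬ τ u) ∧ (σ t ↔ σ u') := by
    by_cases h : τ u ↔ τ u'
    · exact ⟨v', by grind, by grind⟩
    · exact ⟨u', by grind, by grind⟩
  obtain ⟨T, hsT, htT, -, hT, hinj⟩ := hc.exists_tree hn s t t
  have he : s(u, v) ∈ T.edgeSet := by
    by_cases h : σ s
    · exact hσ.mem_edgeSet hT hsT htT h (by grind)
    · exact hσ.mem_edgeSet hT htT hsT (by grind) h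
  have hf : s(u', v') ∈ T.edgeSet := by
    by_cases h : τ s
    · exact hτ.mem_edgeSet hT hsT htT h (by grind)
    · exact hτ.mem_edgeSet hT htT hsT (by grind) h
  exact fun h => hne (hinj he hf h)

lemma IsTree.card_sub_one_le_of_isRainbowColoring [Fintype V] (hG : G.IsTree)
    (hn : 3 ≤ Fintype.card V) {N : ℕ} {c : Sym2 V → Fin N} (hc : IsRainbowColoring G c 3) :
    Fintype.card V - 1 ≤ N := by
  have hbridge := isAcyclic_iff_forall_isBridge.1 hG.isAcyclic
  have hinj : Set.InjOn c G.edgeSet := by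
    rintro ⟨u, v⟩ he ⟨u', v'⟩ hf h
    by_contra hne
    obtain ⟨σ, hσ, hσu, hσv⟩ := IsBridge.exists_changesOnlyAt (hbridge he)
    obtain ⟨τ, hτ, hτu, hτv⟩ := IsBridge.exists_changesOnlyAt (hbridge hf)
    exact hc.ne_of_changesOnlyAt hn he hf hne hσ (by tauto) hτ (by tauto) h
  have h₁ := (isTree_iff_connected_and_card.1 hG).2
  have h₂ := Set.ncard_le_ncard (Set.subset_univ (c '' G.edgeSet))
  rw [hinj.ncard_image, Set.ncard_univ, Nat.card_fin] at h₂
  rw [Nat.card_coe_set_eq, Nat.card_eq_fintype_card] at h₁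
  omega

/-- The side opposite to `t i` in the triangle `t`. -/
def oppositeSide (t : Fin 3 → V) (i : Fin 3) : Sym2 V := s(t (i + 1), t (i + 2))

/-- `π` retracts `G` onto the triangle `t`, moving only along its sides. -/
def IsTriangleRetraction (G : SimpleGraph V) (t : Fin 3 → V) (π : V → Fin 3) : Prop :=
  (∀ i, π (t i) = i) ∧ ∀ ⦃x y⦄, G.Adj x y → π x ≠ π y → ∃ j, s(x, y) = oppositeSide t j

namespace IsTriangleRetraction

variable {t : Fin 3 → V} {π : V → Fin 3}

lemma ne_of_mem_oppositeSide (h : G.IsTriangleRetraction t π) {v : V} {j : Fin 3}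
    (hv : v ∈ oppositeSide t j) : π v ≠ j := by
  rcases Sym2.mem_iff.1 hv with rfl | rfl <;> rw [h.1] <;> revert j <;> simp

lemma oppositeSide_injective (h : G.IsTriangleRetraction t π) :
    Function.Injective (oppositeSide t) := by
  intro i j hij
  have m₁ : t (i + 1) ∈ oppositeSide t j := hij ▸ Sym2.mem_mk_left (t (i + 1)) (t (i + 2))
  have m₂ : t (i + 2) ∈ oppositeSide t j := hij ▸ Sym2.mem_mk_right (t (i + 1)) (t (i + 2))
  have h₁ := h.ne_of_mem_oppositeSide m₁
  have h₂ := h.ne_of_mem_oppositeSide m₂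
  rw [h.1] at h₁ h₂
  clear * - h₁ h₂
  decide +revert

lemma exists_oppositeSide_mem (h : G.IsTriangleRetraction t π) {T : G.Subgraph}
    (hT : T.coe.Connected) {x y : V} (hx : x ∈ T.verts) (hy : y ∈ T.verts) (hxy : π x ≠ π y) :
    ∃ j ≠ π x, oppositeSide t j ∈ T.edgeSet := by
  obtain ⟨u, v, huv, hu, hv⟩ := T.exists_adj_ne hT π hx hy hxy
  obtain ⟨j, hj⟩ := h.2 huv.adj_sub (hu ▸ hv.symm)
  refine ⟨j, fun hjx => ?_, hj ▸ huv⟩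
  exact h.ne_of_mem_oppositeSide (hj ▸ Sym2.mem_mk_left u v) (hu.trans hjx.symm)

lemma exists_forall_ne_mem (h : G.IsTriangleRetraction t π) {T : G.Subgraph}
    (hT : T.coe.Connected) (hsurj : ∀ i, ∃ x ∈ T.verts, π x = i) :
    ∃ m, ∀ j ≠ m, oppositeSide t j ∈ T.edgeSet := by
  have h₁ : ∀ i, ∃ j ≠ i, oppositeSide t j ∈ T.edgeSet := by
    intro i
    obtain ⟨x, hx, rfl⟩ := hsurj i
    obtain ⟨y, hy, hxy⟩ := hsurj (π x + 1)
    exact h.exists_oppositeSide_mem hT hx hy (by rw [hxy]; simp)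
  obtain ⟨i, hi, hiT⟩ := h₁ 0
  obtain ⟨j, hj, hjT⟩ := h₁ i
  obtain ⟨m, hm⟩ : ∃ m : Fin 3, ∀ k ≠ m, k = i ∨ k = j := by
    revert hj
    clear * -
    revert i j
    decide
  exact ⟨m, fun k hk => (hm k hk).elim (· ▸ hiT) (· ▸ hjT)⟩

variable [Fintype V] {α : Type*} {c : Sym2 V → α}

/-- Two sides of the triangle have different colours that occur on no other edge. -/
lemma exists_new_colors (h : G.IsTriangleRetraction t π) (hn : 3 ≤ Fintype.card V)
    (hc : IsRainbowColoring G c 3) (B : Set (Sym2 V)) (hBside : ∀ j, oppositeSide t j ∉ B)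
    (hB : ∀ e ∈ B, ∃ σ : V → Prop, G.ChangesOnlyAt e σ ∧ (∃ x, σ x) ∧ ∀ i, ¬ σ (t i)) :
    ∃ j k, c (oppositeSide t j) ≠ c (oppositeSide t k) ∧ c (oppositeSide t j) ∉ c '' B ∧
      c (oppositeSide t k) ∉ c '' B := by
  have hsurj : ∀ {T : G.Subgraph} {x y z : V}, x ∈ T.verts → y ∈ T.verts → z ∈ T.verts →
      π x ≠ π y → π x ≠ π z → π y ≠ π z → ∀ i, ∃ v ∈ T.verts, π v = i := by
    intro T x y z hx hy hz hxy hxz hyz i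
    obtain hi | hi | hi : π x = i ∨ π y = i ∨ π z = i := by
      generalize π x = a, π y = b, π z = d at *
      clear * - hxy hxz hyz
      decide +revert
    exacts [⟨x, hx, hi⟩, ⟨y, hy, hi⟩, ⟨z, hz, hi⟩]
  -- A tree reaching beyond `e ∈ B` and meeting all three branches.
  have hone : ∀ e ∈ B, ∃ m, (∀ j ≠ m, c (oppositeSide t j) ≠ c e) ∧
      ∀ j ≠ m, ∀ k ≠ m, j ≠ k → c (oppositeSide t j) ≠ c (oppositeSide t k) := by
    intro e he
    obtain ⟨σ, hσ, ⟨x, hx⟩, hσt⟩ := hB e he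
    obtain ⟨T, hxT, h₁T, h₂T, hT, hinj⟩ := hc.exists_tree hn x (t (π x + 1)) (t (π x + 2))
    have heT := hσ.mem_edgeSet hT hxT h₁T hx (hσt _)
    obtain ⟨m, hm⟩ := h.exists_forall_ne_mem hT
      (hsurj hxT h₁T h₂T (by simp [h.1]) (by simp [h.1]) (by simp [h.1]))
    refine ⟨m, fun j hj hje => hBside j ?_, fun j hj k hk hjk hjk' => hjk ?_⟩
    · rwa [hinj (hm j hj) heT hje]
    · exact h.oppositeSide_injective (hinj (hm j hj) (hm k hk) hjk')
  have htri : ∃ m, ∀ j ≠ m, ∀ k ≠ m, j ≠ k →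
      c (oppositeSide t j) ≠ c (oppositeSide t k) := by
    obtain ⟨T, h₀T, h₁T, h₂T, hT, hinj⟩ := hc.exists_tree hn (t 0) (t 1) (t 2)
    obtain ⟨m, hm⟩ := h.exists_forall_ne_mem hT
      (hsurj h₀T h₁T h₂T (by simp [h.1]) (by simp [h.1]) (by simp [h.1]))
    exact ⟨m, fun j hj k hk hjk hjk' =>
      hjk (h.oppositeSide_injective (hinj (hm j hj) (hm k hk) hjk'))⟩
  have htwo : ∀ e ∈ B, ∀ f ∈ B, ∀ j k, j ≠ k → c (oppositeSide t j) = c e →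
      c (oppositeSide t k) = c f → False := by
    intro e he f hf j k hjk hj hk
    obtain ⟨σ, hσ, ⟨x, hx⟩, hσt⟩ := hB e he
    obtain ⟨τ, hτ, ⟨y, hy⟩, hτt⟩ := hB f hf
    have hnot : ∀ {T : G.Subgraph} {g : Sym2 V} {i : Fin 3}, Set.InjOn c T.edgeSet → g ∈ B →
        g ∈ T.edgeSet → c (oppositeSide t i) = c g → oppositeSide t i ∉ T.edgeSet :=
      fun hinj hg hgT hi hiT => hBside _ (hinj hiT hgT hi ▸ hg)
    have hfull : ∀ {T : G.Subgraph}, T.coe.Connected → Set.InjOn c T.edgeSet →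
        e ∈ T.edgeSet → f ∈ T.edgeSet → ¬ ∀ i, ∃ v ∈ T.verts, π v = i := by
      intro T hT hinj heT hfT hall
      obtain ⟨m, hm⟩ := h.exists_forall_ne_mem hT hall
      by_cases hjm : j = m
      · exact hnot hinj hf hfT hk (hm k (hjm ▸ hjk.symm))
      · exact hnot hinj he heT hj (hm j hjm)
    by_cases hxy : π x = π y
    · have hside : ∀ i ≠ π x, ∀ l, l ≠ j → l ≠ k → l ≠ π x ∧ l ≠ i := by
        intro i hi l hlj hlk
        obtain ⟨T, hxT, hyT, hiT, hT, hinj⟩ := hc.exists_tree hn x y (t i)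
        have heT := hσ.mem_edgeSet hT hxT hiT hx (hσt i)
        have hfT := hτ.mem_edgeSet hT hyT hiT hy (hτt i)
        have hl : ∀ l', oppositeSide t l' ∈ T.edgeSet → l' = l := by
          intro l' hl'
          have h₁ : l' ≠ j := by rintro rfl; exact hnot hinj he heT hj hl'
          have h₂ : l' ≠ k := by rintro rfl; exact hnot hinj hf hfT hk hl'
          clear * - hlj hlk h₁ h₂ hjk
          decide +revert
        obtain ⟨l₁, hl₁, hl₁T⟩ := h.exists_oppositeSide_mem hT hxT hiT (by rw [h.1]; exact hi.symm)
        obtain ⟨l₂, hl₂, hl₂T⟩ := h.exists_oppositeSide_mem hT hiT hxT (by rw [h.1]; exact hi)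
        rw [hl l₁ hl₁T] at hl₁
        rw [hl l₂ hl₂T, h.1] at hl₂
        exact ⟨hl₁, hl₂⟩
      generalize π x = a at hside
      clear * - hside hjk
      revert j k a
      decide
    · obtain ⟨i, hxi, hyi⟩ : ∃ i, π x ≠ i ∧ π y ≠ i := by
        generalize π x = a, π y = b
        decide +revert
      obtain ⟨T, hxT, hyT, hiT, hT, hinj⟩ := hc.exists_tree hn x y (t i)
      exact hfull hT hinj (hσ.mem_edgeSet hT hxT hiT hx (hσt i))
        (hτ.mem_edgeSet hT hyT hiT hy (hτt i))
        (hsurj hxT hyT hiT hxy (by rwa [h.1]) (by rwa [h.1]))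
  generalize hK : (fun j => c (oppositeSide t j)) = K
  have hK' : ∀ j, c (oppositeSide t j) = K j := fun j => congrFun hK j
  simp only [hK'] at hone htri htwo ⊢
  by_contra! hcon
  have hinj : ∀ j k, j ≠ k → K j ≠ K k := by
    intro j k hjk heq
    obtain ⟨l, hlj, hlk⟩ : ∃ l : Fin 3, l ≠ j ∧ l ≠ k := by
      clear * -
      decide +revert
    have hthird : ∀ m : Fin 3, m = j ∨ m = k ∨ m = l := by
      clear * - hjk hlj hlk
      decide +revert
    have hne : K j ≠ K l := by
      obtain ⟨m, hm⟩ := htri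
      grind
    have hmem := hcon j l hne
    by_cases hjB : K j ∈ c '' B
    · obtain ⟨e, he, hej⟩ := hjB
      obtain ⟨m, hm, -⟩ := hone e he
      grind
    · obtain ⟨e, he, hel⟩ := hmem hjB
      obtain ⟨m, hm, hm'⟩ := hone e he
      grind
  obtain ⟨j, k, hjk, ⟨e, he, hej⟩, ⟨f, hf, hfk⟩⟩ :
      ∃ j k, j ≠ k ∧ K j ∈ c '' B ∧ K k ∈ c '' B := by
    by_cases h₀ : K 0 ∈ c '' B
    · by_cases h₁ : K 1 ∈ c '' B
      · exact ⟨0, 1, by decide, h₀, h₁⟩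
      · exact ⟨0, 2, by decide, h₀, hcon 1 2 (hinj _ _ (by decide)) h₁⟩
    · exact ⟨1, 2, by decide, hcon 0 1 (hinj _ _ (by decide)) h₀,
        hcon 0 2 (hinj _ _ (by decide)) h₀⟩
  exact htwo e he f hf j k hjk hej.symm hfk.symm

end IsTriangleRetraction

/-- In a connected graph with as many edges as vertices, the edges off a triangle are bridges
and the triangle is a retract. -/
lemma Connected.exists_isTriangleRetraction [Fintype V] (hG : G.Connected)
    (hcard : G.edgeSet.ncard = Fintype.card V) {a b c : V} (hab : G.Adj a b) (hbc : G.Adj b c)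
    (hca : G.Adj c a) :
    (∃ π, G.IsTriangleRetraction ![a, b, c] π) ∧
      ∀ u v, G.Adj u v → (∀ j, s(u, v) ≠ oppositeSide ![a, b, c] j) →
        ∃ σ : V → Prop, G.ChangesOnlyAt s(u, v) σ ∧ (σ u ↔ ¬ σ v) ∧
          ∀ i, ¬ σ (![a, b, c] i) := by
  have hside : ∀ e, (∃ j, e = oppositeSide ![a, b, c] j) ↔
      e = s(b, c) ∨ e = s(c, a) ∨ e = s(a, b) := by
    simp [Fin.exists_fin_succ, oppositeSide]
  let H := G.deleteEdges {s(a, b)}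
  have hadj : ∀ {x y}, G.Adj x y → s(x, y) ≠ s(a, b) → H.Adj x y := fun h hne =>
    deleteEdges_adj.2 ⟨h, hne⟩
  have hcon : H.Connected := connected_deleteEdges_of_triangle hG hbc hca
  have hncard : H.edgeSet.ncard + 1 = _ := ncard_edgeSet_deleteEdges_singleton hab
  have htree : H.IsTree := by
    rw [isTree_iff_connected_and_card, Nat.card_coe_set_eq, Nat.card_eq_fintype_card]
    exact ⟨hcon, by omega⟩
  have hbridge := isAcyclic_iff_forall_isBridge.1 htree.isAcyclic
  have hHbc : H.Adj b c := hadj hbc (by simp [hbc.ne', hca.ne])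
  have hHac : H.Adj a c := hadj hca.symm (by simp [hbc.ne', hca.ne])
  have hbc_ac : s(b, c) ≠ s(a, c) := by simp [hab.ne', hbc.ne]
  constructor
  · obtain ⟨σ, hσ, hσa, hσc⟩ := IsBridge.exists_changesOnlyAt (hbridge hHac)
    obtain ⟨τ, hτ, hτb, hτc⟩ := IsBridge.exists_changesOnlyAt (hbridge hHbc)
    have hσb : ¬ σ b := fun h => hσc ((hσ hHbc hbc_ac).1 h)
    classical
    refine ⟨fun x => if σ x then 0 else if τ x then 1 else 2, ?_, fun x y hxy hne => ?_⟩
    · simp [Fin.forall_fin_succ, hσa, hσb, hσc, hτb, hτc]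
    · rw [hside]
      by_contra! h
      have hxyH := hadj hxy h.2.2
      have h₁ := hσ hxyH (Sym2.eq_swap (a := a) ▸ h.2.1)
      have h₂ := hτ hxyH h.1
      exact hne (by simp [h₁, h₂])
  · intro u v huv hne
    have hne' := mt (hside s(u, v)).2 (not_exists.2 hne)
    push Not at hne'
    have huvH := hadj huv hne'.2.2
    obtain ⟨σ, hσ, hσu, hσv⟩ := IsBridge.exists_changesOnlyAt (hbridge huvH)
    have h₁ : σ b ↔ σ c := hσ hHbc hne'.1.symm
    have h₂ : σ a ↔ σ c := hσ hHac (Sym2.eq_swap (a := a) ▸ hne'.2.1.symm)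
    have hσG : G.ChangesOnlyAt s(u, v) σ := by
      intro x y hxy hxyne
      by_cases hxyab : s(x, y) = s(a, b)
      · rcases Sym2.eq_iff.1 hxyab with ⟨rfl, rfl⟩ | ⟨rfl, rfl⟩
        · exact h₂.trans h₁.symm
        · exact h₁.trans h₂.symm
      · exact hσ (hadj hxy hxyab) hxyne
    by_cases h : σ c
    · refine ⟨fun x => ¬ σ x, fun x y hxy hxyne => not_congr (hσG hxy hxyne), by simp [hσu, hσv],
        ?_⟩
      simp [Fin.forall_fin_succ, h, h₁, h₂]
    · refine ⟨σ, hσG, by simp [hσu, hσv], ?_⟩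
      simp [Fin.forall_fin_succ, h, h₁, h₂]

lemma Connected.card_sub_one_le_of_isRainbowColoring_of_triangle [Fintype V] (hG : G.Connected)
    (hn : 3 ≤ Fintype.card V) (hcard : G.edgeSet.ncard = Fintype.card V) {x y z : V}
    (hxy : G.Adj x y) (hyz : G.Adj y z) (hzx : G.Adj z x) {N : ℕ} {c : Sym2 V → Fin N}
    (hc : IsRainbowColoring G c 3) : Fintype.card V - 1 ≤ N := by
  obtain ⟨⟨π, hπ⟩, hcut⟩ := hG.exists_isTriangleRetraction hcard hxy hyz hzx
  set t := ![x, y, z]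
  let B : Set (Sym2 V) := G.edgeSet \ Set.range (oppositeSide t)
  have hsub : Set.range (oppositeSide t) ⊆ G.edgeSet := by
    rintro _ ⟨j, rfl⟩
    fin_cases j
    exacts [hyz, hzx, hxy]
  have hBne : ∀ {e}, e ∈ B → ∀ j, e ≠ oppositeSide t j := fun he j h => he.2 ⟨j, h.symm⟩
  have hBcard : B.ncard + 3 = Fintype.card V := by
    have h₁ : B.ncard + _ = _ := Set.ncard_sdiff_add_ncard_of_subset hsub
    rw [← Set.image_univ, hπ.oppositeSide_injective.injOn.ncard_image, Set.ncard_univ,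
      Nat.card_fin] at h₁
    omega
  have hinj : Set.InjOn c B := by
    rintro ⟨u, v⟩ he ⟨u', v'⟩ hf h
    by_contra hne
    obtain ⟨σ, hσ, hσuv, -⟩ := hcut u v he.1 (hBne he)
    obtain ⟨τ, hτ, hτuv, -⟩ := hcut u' v' hf.1 (hBne hf)
    exact hc.ne_of_changesOnlyAt hn he.1 hf.1 hne hσ hσuv hτ hτuv h
  obtain ⟨j, k, hjk, hj, hk⟩ := hπ.exists_new_colors hn hc B (fun j h => h.2 ⟨j, rfl⟩) (by
    rintro ⟨u, v⟩ he
    obtain ⟨σ, hσ, hσuv, hσt⟩ := hcut u v he.1 (hBne he)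
    refine ⟨σ, hσ, ?_, hσt⟩
    by_cases h : σ u
    · exact ⟨u, h⟩
    · exact ⟨v, not_not.1 (mt hσuv.2 h)⟩)
  have hle := Set.ncard_le_ncard (Set.subset_univ
    (insert (c (oppositeSide t j)) (insert (c (oppositeSide t k)) (c '' B))))
  rw [Set.ncard_insert_of_notMem (by simp only [Set.mem_insert_iff, not_or]; exact ⟨hjk, hj⟩),
    Set.ncard_insert_of_notMem hk, hinj.ncard_image, Set.ncard_univ, Nat.card_fin] at hle
  omega

end SimpleGraph

theorem stmt_10 {V : Type*} [Fintype V] (G : SimpleGraph V) (hG : G.Connected)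
    (hn : 3 ≤ Fintype.card V) :
    rxk G 3 = Fintype.card V - 1 ↔
      G.IsTree ∨ (G.edgeSet.ncard = Fintype.card V ∧ G.girth = 3) := by
  constructor
  · intro h
    by_contra hcon
    rw [not_or] at hcon
    have := hG.rxk_three_le_card_sub_two hcon.1 hcon.2
    omega
  · intro h
    have hcol := hG.exists_isRainbowColoring (by omega) 3
    refine le_antisymm (Nat.sInf_le hcol) (le_csInf ⟨_, hcol⟩ ?_)
    rintro q ⟨c, hc⟩
    rcases h with hT | ⟨hcard, hgirth⟩
    · exact hT.card_sub_one_le_of_isRainbowColoring hn hc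
    · have hacyc : ¬ G.IsAcyclic := fun h => by
        rw [girth_eq_zero.2 h] at hgirth
        omega
      obtain ⟨x, w, -, hw⟩ := exists_girth_eq_length.2 hacyc
      obtain ⟨a, b, hxa, hab, hbx⟩ := w.exists_triangle_of_length_eq_three (hw ▸ hgirth)
      exact hG.card_sub_one_le_of_isRainbowColoring_of_triangle hn hcard hxa hab hbx hc
end

section
/- If a connected graph $G$ of order $n$ contains two distinct triangles (cycles of length 3), then $rx_3(G) \leq n - 2$. -/
open SimpleGraph

/-- Some connected subgraph with vertex set `U` is rainbow under `c`, with colors in `K`. -/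
def RainbowSpans {V : Type*} (G : SimpleGraph V) (c : Sym2 V → ℕ) (U : Finset V)
    (K : Set ℕ) : Prop :=
  ∃ T : G.Subgraph, T.verts = ↑U ∧ T.Connected ∧ Set.InjOn c T.edgeSet ∧
    ∀ e ∈ T.edgeSet, c e ∈ K

/-- `c` uses at most `|W| - 2` colors, and any at most three vertices of `W` lie in a
rainbow connected subgraph inside `W`. -/
def RainbowCore {V : Type*} (G : SimpleGraph V) (c : Sym2 V → ℕ) (W : Finset V) : Prop :=
  (∀ e, c e + 2 < W.card) ∧
    ∀ S ⊆ W, S.card ≤ 3 → ∃ U ⊆ W, S ⊆ U ∧ RainbowSpans G c U {i | i + 2 < W.card}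

section

variable {V : Type*} {G : SimpleGraph V} {c c' : Sym2 V → ℕ} {U W : Finset V} {K L : Set ℕ}

theorem RainbowSpans.mono (h : RainbowSpans G c U K) (hKL : K ⊆ L) : RainbowSpans G c U L := by
  obtain ⟨T, h1, h2, h3, h4⟩ := h
  exact ⟨T, h1, h2, h3, fun e he => hKL (h4 e he)⟩

theorem RainbowSpans.congr (h : RainbowSpans G c U K)
    (hc : ∀ x ∈ U, ∀ y ∈ U, c' s(x, y) = c s(x, y)) : RainbowSpans G c' U K := by
  obtain ⟨T, h1, h2, h3, h4⟩ := h
  have key : ∀ e ∈ T.edgeSet, c' e = c e := by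
    intro e
    induction e using Sym2.ind with
    | _ x y =>
      intro he
      have hx : x ∈ T.verts := T.edge_vert he
      have hy : y ∈ T.verts := T.edge_vert (T.adj_symm he)
      rw [h1] at hx hy
      exact hc x hx y hy
  refine ⟨T, h1, h2, h3.congr fun e he => (key e he).symm, fun e he => ?_⟩
  rw [key e he]
  exact h4 e he

theorem rainbowSpans_singleton (v : V) : RainbowSpans G c {v} K :=
  ⟨G.singletonSubgraph v, by simp, Subgraph.singletonSubgraph_connected, by simp, by simp⟩

theorem RainbowSpans.insert [DecidableEq V] (h : RainbowSpans G c U K) {u v : V} (hu : u ∈ U)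
    (huv : G.Adj u v) (hc : c s(u, v) ∉ K) :
    RainbowSpans G c (insert v U) (insert (c s(u, v)) K) := by
  obtain ⟨T, h1, h2, h3, h4⟩ := h
  refine ⟨T ⊔ G.subgraphOfAdj huv, ?_, ?_, ?_, ?_⟩
  · ext x
    simp only [Subgraph.verts_sup, h1, subgraphOfAdj_verts, Finset.coe_insert, Set.mem_union,
      Set.mem_insert_iff, Set.mem_singleton_iff, Finset.mem_coe]
    grind
  · refine Subgraph.connected_sup h2.preconnected
      (Subgraph.subgraphOfAdj_connected huv).preconnected ⟨u, ?_⟩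
    simp [h1, hu]
  · rw [Subgraph.edgeSet_sup, edgeSet_subgraphOfAdj]
    intro e he e' he' hee
    rcases he with he | he <;> rcases he' with he' | he'
    · exact h3 he he' hee
    · rw [Set.mem_singleton_iff] at he'
      subst he'
      exact absurd (hee ▸ h4 e he) hc
    · rw [Set.mem_singleton_iff] at he
      subst he
      exact absurd (hee ▸ h4 e' he') hc
    · rw [Set.mem_singleton_iff] at he he'
      rw [he, he']
  · rw [Subgraph.edgeSet_sup, edgeSet_subgraphOfAdj]
    rintro e (he | he)
    · exact Or.inr (h4 e he)
    · rw [Set.mem_singleton_iff] at he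
      exact Or.inl (by rw [he])

theorem rainbowSpans_of_adj_of_adj [DecidableEq V] {x y z : V} (hxy : G.Adj x y)
    (hyz : G.Adj y z) (hc : c s(x, y) ≠ c s(y, z)) :
    RainbowSpans G c {z, y, x} {c s(y, z), c s(x, y)} := by
  have h := (rainbowSpans_singleton (G := G) (c := c) (K := ∅) x).insert
    (Finset.mem_singleton_self x) hxy (by simp)
  have hpath := h.insert (by simp) hyz (by simpa using hc.symm)
  exact hpath.mono (by simp)

/-- The edges of a path are rainbow when each is colored by its position. -/
theorem rainbowSpans_support [DecidableEq V] {u v : V} (p : G.Walk u v) :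
    RainbowSpans G (fun e => p.edges.idxOf e) p.support.toFinset {i | i < p.length} := by
  refine ⟨p.toSubgraph, by ext; simp, p.toSubgraph_connected, ?_, ?_⟩
  · intro e he e' _ hee
    rw [Walk.mem_edges_toSubgraph] at he
    exact (List.idxOf_inj he).1 hee
  · intro e he
    rw [Walk.mem_edges_toSubgraph] at he
    rw [← p.length_edges]
    exact List.idxOf_lt_length_iff.2 he

/-- A connected subgraph contains a tree on the same vertices. -/
theorem SimpleGraph.Subgraph.Connected.exists_isTree_le [Finite V] {T : G.Subgraph}
    (hT : T.Connected) :
    ∃ T' ≤ T, T'.verts = T.verts ∧ T'.coe.IsTree := by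
  obtain ⟨H, hH, htree⟩ := hT.coe.exists_isTree_le
  let T' : G.Subgraph :=
    { verts := T.verts
      Adj := fun x y => ∃ hx hy, H.Adj ⟨x, hx⟩ ⟨y, hy⟩
      adj_sub := fun ⟨_, _, h⟩ => T.adj_sub (hH h)
      edge_vert := fun ⟨hx, _, _⟩ => hx
      symm := ⟨fun _ _ ⟨hx, hy, h⟩ => ⟨hy, hx, h.symm⟩⟩ }
  have hcoe : T'.coe = H := by
    ext ⟨x, hx⟩ ⟨y, hy⟩
    exact ⟨fun ⟨_, _, h⟩ => h, fun h => ⟨hx, hy, h⟩⟩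
  exact ⟨T', ⟨le_rfl, fun _ _ ⟨_, _, h⟩ => hH h⟩, rfl, hcoe ▸ htree⟩

theorem RainbowCore.insert [DecidableEq V] (h : RainbowCore G c W) {w v : V} (hw : w ∈ W)
    (hv : v ∉ W) (hwv : G.Adj w v) :
    RainbowCore G (Function.update c s(w, v) (W.card - 2)) (insert v W) := by
  obtain ⟨h1, h2⟩ := h
  have hpos := h1 s(w, v)
  have hcard : (Insert.insert v W).card = W.card + 1 := Finset.card_insert_of_notMem hv
  refine ⟨fun e => ?_, fun S hS hS3 => ?_⟩
  · rw [hcard, Function.update_apply]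
    have := h1 e
    split_ifs <;> omega
  · have lift : ∀ U ⊆ W, RainbowSpans G c U {i | i + 2 < W.card} →
        RainbowSpans G (Function.update c s(w, v) (W.card - 2)) U {i | i + 2 < W.card} := by
      intro U hU hs
      refine hs.congr fun x hx y hy => Function.update_of_ne ?_ _ _
      intro he
      have hmem : v ∈ s(x, y) := he ▸ Sym2.mem_mk_right w v
      rcases Sym2.mem_iff.1 hmem with rfl | rfl
      · exact hv (hU hx)
      · exact hv (hU hy)
    rw [hcard]
    by_cases hvS : v ∈ S
    · obtain ⟨U, hU, hSU, hs⟩ := h2 (Insert.insert w (S.erase v)) (by grind)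
        ((Finset.card_insert_le _ _).trans (by rwa [Finset.card_erase_add_one hvS]))
      refine ⟨Insert.insert v U, Finset.insert_subset_insert v hU, by grind,
        ((lift U hU hs).insert (hSU (by simp)) hwv ?_).mono ?_⟩
      · simp only [Function.update_self, Set.mem_ofPred_eq]
        omega
      · rw [Function.update_self]
        rintro i (rfl | hi)
        · simp only [Set.mem_ofPred_eq]
          omega
        · simp only [Set.mem_ofPred_eq] at hi ⊢
          omega
    · obtain ⟨U, hU, hSU, hs⟩ := h2 S (by grind) hS3
      refine ⟨U, by grind, hSU, (lift U hU hs).mono fun i hi => ?_⟩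
      simp only [Set.mem_ofPred_eq] at hi ⊢
      omega

/-- A core of a connected graph grows to all vertices. -/
theorem RainbowCore.exists_univ [Fintype V] (hG : G.Connected) (h : RainbowCore G c W) :
    ∃ c', RainbowCore G c' Finset.univ := by
  classical
  induction hn : Wᶜ.card generalizing W c with
  | zero =>
    rw [Finset.card_eq_zero, Finset.compl_eq_empty_iff] at hn
    exact ⟨c, hn ▸ h⟩
  | succ n ih =>
    obtain ⟨y, hy⟩ : Wᶜ.Nonempty := Finset.card_pos.1 (by omega)
    have hpos := h.1 s(y, y)
    obtain ⟨x, hx⟩ : W.Nonempty := Finset.card_pos.1 (by omega)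
    obtain ⟨p⟩ := hG.preconnected x y
    obtain ⟨d, -, hd, hd'⟩ := p.exists_boundary_dart (↑W : Set V) hx (by simpa using hy)
    refine ih (h.insert hd hd' d.adj) ?_
    rw [Finset.compl_insert, Finset.card_erase_of_mem (by simpa using hd'), hn]
    rfl

theorem RainbowCore.rxk_le [Fintype V] (h : RainbowCore G c Finset.univ) :
    rxk G 3 ≤ Fintype.card V - 2 := by
  obtain ⟨h1, h2⟩ := h
  refine Nat.sInf_le ⟨fun e => ⟨c e, ?_⟩, fun S hS => ?_⟩
  · have := h1 e
    rw [Finset.card_univ] at this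
    omega
  · obtain ⟨U, -, hSU, T, hT, hconn, hinj, -⟩ := h2 S (Finset.subset_univ S) hS.le
    obtain ⟨T', hle, hverts, htree⟩ := hconn.exists_isTree_le
    refine ⟨T', ?_, htree, fun e he e' he' hee => ?_⟩
    · rw [hverts, hT]
      exact_mod_cast hSU
    · exact hinj (Subgraph.edgeSet_mono hle he) (Subgraph.edgeSet_mono hle he')
        (congrArg Fin.val hee)

/-- Two triangles sharing the edge `xy`. -/
theorem exists_rainbowCore_of_common_edge {a x y b : V} (hax : G.Adj a x) (hay : G.Adj a y)
    (hbx : G.Adj b x) (hby : G.Adj b y) (hxy : G.Adj x y) (hab : a ≠ b) :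
    ∃ c W, RainbowCore G c W := by
  classical
  let c : Sym2 V → ℕ := fun e => if e = s(a, x) ∨ e = s(b, y) then 0 else 1
  have hcard : ({a, x, y, b} : Finset V).card = 4 := by
    simp [hax.ne, hay.ne, hab, hxy.ne, hbx.ne', hby.ne']
  have hc : ∀ e, c e + 2 < 4 := by
    intro e
    simp only [c]
    split_ifs <;> omega
  have hax' : c s(x, a) = 0 := by simp [c]
  have hby' : c s(y, b) = 0 := by simp [c]
  have hay' : c s(y, a) = 1 := by simp [c, hax.ne, hay.ne, hab, hby.ne', hxy.ne']
  have hbx' : c s(x, b) = 1 := by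
    simp [c, hax.ne', hab.symm, hxy.ne, hbx.ne', hbx.ne]
  refine ⟨c, {a, x, y, b}, hcard ▸ hc, fun S hS hS3 => ?_⟩
  rw [hcard]
  obtain ⟨z, hz, hzS⟩ : ∃ z ∈ ({a, x, y, b} : Finset V), z ∉ S := by
    by_contra! hcon
    have := Finset.card_le_card (show ({a, x, y, b} : Finset V) ⊆ S from hcon)
    omega
  have key : ∀ {i j k : V}, G.Adj i j → G.Adj j k → c s(i, j) ≠ c s(j, k) →
      RainbowSpans G c {k, j, i} {i | i + 2 < 4} := fun hij hjk hne =>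
    (rainbowSpans_of_adj_of_adj hij hjk hne).mono (by
      rintro _ (rfl | rfl) <;> exact hc _)
  simp only [Finset.mem_insert, Finset.mem_singleton] at hz
  rcases hz with rfl | rfl | rfl | rfl
  · exact ⟨{y, b, x}, by grind, by grind, key hbx.symm hby (by
      rw [Sym2.eq_swap (a := b), hbx', hby']; simp)⟩
  · exact ⟨{b, y, a}, by grind, by grind, key hay hby.symm (by
      rw [Sym2.eq_swap (a := a), hay', hby']; simp)⟩
  · exact ⟨{b, x, a}, by grind, by grind, key hax hbx.symm (by
      rw [Sym2.eq_swap (a := a), hax', hbx']; simp)⟩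
  · exact ⟨{y, a, x}, by grind, by grind, key hax.symm hay (by
      rw [Sym2.eq_swap (a := a), hax', hay']; simp)⟩

/-- Two edge-disjoint triangles `uab` and `vde` joined by a path from `u` to `v`. -/
theorem exists_rainbowCore_of_path {u v a b d e : V} {p : G.Walk u v} (hp : p.IsPath)
    (hua : G.Adj u a) (hub : G.Adj u b) (hab : G.Adj a b)
    (hvd : G.Adj v d) (hve : G.Adj v e) (hde : G.Adj d e)
    (ha : a ∉ p.support) (hb : b ∉ p.support) (hd : d ∉ p.support) (he : e ∉ p.support)
    (had : a ≠ d) (hae : a ≠ e) (hbd : b ≠ d) (hbe : b ≠ e) :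
    ∃ c W, RainbowCore G c W := by
  classical
  have hu := p.start_mem_support
  have hv := p.end_mem_support
  have hab' := hab.ne
  have hde' := hde.ne
  let P := p.support.toFinset
  have hPcard : P.card = p.length + 1 := by
    rw [List.toFinset_card_of_nodup hp.support_nodup, p.length_support]
  let c : Sym2 V → ℕ := fun f =>
    if f = s(u, a) ∨ f = s(u, b) then p.length
    else if f = s(a, b) ∨ f = s(d, e) then p.length + 1
    else if f = s(v, d) ∨ f = s(v, e) then p.length + 2
    else p.edges.idxOf f
  have hc : ∀ f, c f < p.length + 3 := by
    intro f
    have : p.edges.idxOf f ≤ p.edges.length := List.idxOf_le_length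
    rw [p.length_edges] at this
    simp only [c]
    split_ifs <;> omega
  have hP : RainbowSpans G c P {i | i < p.length} := by
    refine (rainbowSpans_support p).congr fun x hx y hy => ?_
    have hx : x ∈ p.support := by simpa [P] using hx
    have hy : y ∈ p.support := by simpa [P] using hy
    simp only [c, Sym2.eq_iff]
    grind
  have c1 : c s(u, a) = p.length := by simp [c]
  have c2 : c s(u, b) = p.length := by simp [c]
  have c3 : c s(a, b) = p.length + 1 := by simp only [c, Sym2.eq_iff]; grind
  have c4 : c s(d, e) = p.length + 1 := by simp only [c, Sym2.eq_iff]; grind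
  have c5 : c s(v, d) = p.length + 2 := by simp only [c, Sym2.eq_iff]; grind
  have c6 : c s(v, e) = p.length + 2 := by simp only [c, Sym2.eq_iff]; grind
  have huP : u ∈ P := by simp [P]
  have hvP : v ∈ P := by simp [P]
  have hW : (insert a (insert b (insert d (insert e P)))).card = p.length + 5 := by
    rw [Finset.card_insert_of_notMem, Finset.card_insert_of_notMem, Finset.card_insert_of_notMem,
      Finset.card_insert_of_notMem, hPcard] <;>
      simp [P, *]
  clear_value c P
  have key : ∀ {x y z r s t : V}, G.Adj r x → G.Adj s y → G.Adj t z → r ∈ P →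
      s ∈ insert x P → t ∈ insert y (insert x P) →
      p.length ≤ c s(r, x) → p.length ≤ c s(s, y) → p.length ≤ c s(t, z) →
      c s(s, y) ≠ c s(r, x) → c s(t, z) ≠ c s(s, y) → c s(t, z) ≠ c s(r, x) →
      RainbowSpans G c (insert z (insert y (insert x P))) {i | i + 2 < p.length + 5} := by
    intro x y z r s t hx hy hz hr hs ht lx ly lz n1 n2 n3
    refine (((hP.insert hr hx (by simpa using lx)).insert hs hy (by simpa using ⟨n1, ly⟩)).insert
      ht hz (by simpa using ⟨n2, n3, lz⟩)).mono ?_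
    rintro i (rfl | rfl | rfl | hi)
    · have := hc s(t, z)
      simp only [Set.mem_ofPred_eq]
      omega
    · have := hc s(s, y)
      simp only [Set.mem_ofPred_eq]
      omega
    · have := hc s(r, x)
      simp only [Set.mem_ofPred_eq]
      omega
    · simp only [Set.mem_ofPred_eq] at hi ⊢
      omega
  refine ⟨c, insert a (insert b (insert d (insert e P))), fun f => ?_, fun S hS hS3 => ?_⟩
  · have := hc f
    omega
  rw [hW]
  obtain ⟨z, hz, hzS⟩ : ∃ z ∈ ({a, b, d, e} : Finset V), z ∉ S := by
    by_contra! hcon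
    have := Finset.card_le_card (show ({a, b, d, e} : Finset V) ⊆ S from hcon)
    have h4 : ({a, b, d, e} : Finset V).card = 4 := by
      simp [*]
    omega
  have c3' : c s(b, a) = p.length + 1 := by rw [Sym2.eq_swap, c3]
  have c4' : c s(e, d) = p.length + 1 := by rw [Sym2.eq_swap, c4]
  simp only [Finset.mem_insert, Finset.mem_singleton] at hz
  rcases hz with rfl | rfl | rfl | rfl
  · exact ⟨insert e (insert d (insert b P)), by clear * -; grind, by clear * - hS hzS; grind,
      key hub hvd hde (by simp [*]) (by simp [*]) (by simp) (by omega) (by omega) (by omega)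
        (by omega) (by omega) (by omega)⟩
  · exact ⟨insert e (insert d (insert a P)), by clear * -; grind, by clear * - hS hzS; grind,
      key hua hvd hde (by simp [*]) (by simp [*]) (by simp) (by omega) (by omega) (by omega)
        (by omega) (by omega) (by omega)⟩
  · exact ⟨insert b (insert a (insert e P)), by clear * -; grind, by clear * - hS hzS; grind,
      key hve hua hab (by simp [*]) (by simp [*]) (by simp) (by omega) (by omega) (by omega)
        (by omega) (by omega) (by omega)⟩
  · exact ⟨insert b (insert a (insert d P)), by clear * -; grind, by clear * - hS hzS; grind,
      key hvd hua hab (by simp [*]) (by simp [*]) (by simp) (by omega) (by omega) (by omega)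
        (by omega) (by omega) (by omega)⟩

/-- The other two vertices of a triangle through `u`. -/
theorem SimpleGraph.IsNClique.exists_eq_insert_pair [DecidableEq V] {S : Finset V}
    (hS : G.IsNClique 3 S) {u : V} (hu : u ∈ S) :
    ∃ a b, G.Adj u a ∧ G.Adj u b ∧ G.Adj a b ∧ S = {u, a, b} := by
  obtain ⟨x, y, z, hxy, hxz, hyz, rfl⟩ := is3Clique_iff.1 hS
  simp only [Finset.mem_insert, Finset.mem_singleton] at hu
  rcases hu with rfl | rfl | rfl
  · exact ⟨y, z, hxy, hxz, hyz, rfl⟩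
  · exact ⟨x, z, hxy.symm, hyz, hxz, by grind⟩
  · exact ⟨x, y, hxz.symm, hyz.symm, hxy, by grind⟩

theorem exists_rainbowCore_of_two_triangles (hG : G.Connected) {S T : Finset V}
    (hS : G.IsNClique 3 S) (hT : G.IsNClique 3 T) (hST : S ≠ T) : ∃ c W, RainbowCore G c W := by
  classical
  by_cases hcommon : ∃ x ∈ S, x ∈ T ∧ ∃ y ∈ S, y ∈ T ∧ x ≠ y
  · obtain ⟨x, hxS, hxT, y, hyS, hyT, hxy⟩ := hcommon
    have third : ∀ {R : Finset V}, G.IsNClique 3 R → x ∈ R → y ∈ R →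
        ∃ a, G.Adj a x ∧ G.Adj a y ∧ R = {x, y, a} := by
      intro R hR hxR hyR
      obtain ⟨a, b, hxa, hxb, hab, rfl⟩ := hR.exists_eq_insert_pair hxR
      simp only [Finset.mem_insert, Finset.mem_singleton] at hyR
      rcases hyR with rfl | rfl | rfl
      · exact absurd rfl hxy
      · exact ⟨b, hxb.symm, hab.symm, rfl⟩
      · exact ⟨a, hxa.symm, hab, by grind⟩
    obtain ⟨a, hax, hay, hSa⟩ := third hS hxS hyS
    obtain ⟨b, hbx, hby, hTb⟩ := third hT hxT hyT
    refine exists_rainbowCore_of_common_edge hax hay hbx hby (hS.isClique hxS hyS hxy) ?_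
    rintro rfl
    exact hST (hSa.trans hTb.symm)
  · push Not at hcommon
    obtain ⟨s, hs⟩ : S.Nonempty := Finset.card_pos.1 (by rw [hS.card_eq]; omega)
    obtain ⟨t, ht⟩ : T.Nonempty := Finset.card_pos.1 (by rw [hT.card_eq]; omega)
    obtain ⟨⟨u, v⟩, huv, hmin⟩ := (S ×ˢ T).exists_min_image (fun q => G.dist q.1 q.2)
      ⟨(s, t), Finset.mk_mem_product hs ht⟩
    obtain ⟨hu, hv⟩ := Finset.mem_product.1 huv
    dsimp only at hu hv hmin
    obtain ⟨p, hp, hlen⟩ := hG.exists_path_of_dist u v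
    have hsplit : ∀ x ∈ p.support, G.dist u x + G.dist x v ≤ G.dist u v := by
      intro x hx
      have h1 := dist_le (p.takeUntil x hx)
      have h2 := dist_le (p.dropUntil x hx)
      have h3 := congrArg Walk.length (p.take_spec hx)
      rw [Walk.length_append] at h3
      omega
    have hSp : ∀ x ∈ S, x ∈ p.support → u = x := by
      intro x hx hxp
      have h1 := hsplit x hxp
      have h2 := hmin (x, v) (Finset.mk_mem_product hx hv)
      dsimp only at h2
      exact hG.dist_eq_zero_iff.1 (by omega)
    have hTp : ∀ x ∈ T, x ∈ p.support → v = x := by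
      intro x hx hxp
      have h1 := hsplit x hxp
      have h2 := hmin (u, x) (Finset.mk_mem_product hu hx)
      dsimp only at h2
      exact (hG.dist_eq_zero_iff.1 (by omega)).symm
    have hinter : ∀ x ∈ S, x ∈ T → u = x := by
      intro x hxS hxT
      have h2 := hmin (x, x) (Finset.mk_mem_product hxS hxT)
      dsimp only at h2
      rw [dist_self] at h2
      have huv : u = v := hG.dist_eq_zero_iff.1 (by omega)
      exact hcommon u hu (huv ▸ hv) x hxS hxT
    obtain ⟨a, b, hua, hub, hab, rfl⟩ := hS.exists_eq_insert_pair hu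
    obtain ⟨d, e, hvd, hve, hde, rfl⟩ := hT.exists_eq_insert_pair hv
    refine exists_rainbowCore_of_path hp hua hub hab hvd hve hde
      (fun h => hua.ne (hSp a (by simp) h)) (fun h => hub.ne (hSp b (by simp) h))
      (fun h => hvd.ne (hTp d (by simp) h)) (fun h => hve.ne (hTp e (by simp) h)) ?_ ?_ ?_ ?_
    · rintro rfl
      exact hua.ne (hinter a (by simp) (by simp))
    · rintro rfl
      exact hua.ne (hinter a (by simp) (by simp))
    · rintro rfl
      exact hub.ne (hinter b (by simp) (by simp))
    · rintro rfl
      exact hub.ne (hinter b (by simp) (by simp))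

end

theorem stmt_12 {V : Type*} [Fintype V] (G : SimpleGraph V) (hG : G.Connected)
    (S T : Finset V) (hS : G.IsNClique 3 S) (hT : G.IsNClique 3 T) (hST : S ≠ T) :
    rxk G 3 ≤ Fintype.card V - 2 := by
  obtain ⟨c, W, h⟩ := exists_rainbowCore_of_two_triangles hG hS hT hST
  obtain ⟨c', h'⟩ := h.exists_univ hG
  exact h'.rxk_le
end

section
/- If $G$ is a 2-edge-connected graph of order $n \geq 4$, then $rx_3(G) \leq n - 2$. -/
open SimpleGraph

/-- If each of three distinct values occurs among `a, b, d`, no other value does. -/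
theorem eq_or_eq_or_eq_of_covers {α : Type*} {a b d x v w : α} (hxv : x ≠ v) (hxw : x ≠ w)
    (hvw : v ≠ w) (hx : ¬(a ≠ x ∧ b ≠ x ∧ d ≠ x)) (hv : ¬(a ≠ v ∧ b ≠ v ∧ d ≠ v))
    (hw : ¬(a ≠ w ∧ b ≠ w ∧ d ≠ w)) :
    (a = x ∨ a = v ∨ a = w) ∧ (b = x ∨ b = v ∨ b = w) ∧ (d = x ∨ d = v ∨ d = w) := by
  grind

/-- Any vertices joined inside a rainbow subgraph `K` lie in a common rainbow tree. -/
theorem exists_rainbow_tree {V α : Type*} {G K : SimpleGraph V} (hK : K ≤ G) {c : Sym2 V → α}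
    (hc : Set.InjOn c K.edgeSet) {S : Set V} {r : V} (hS : ∀ s ∈ S, K.Reachable r s) :
    ∃ T : G.Subgraph, S ⊆ T.verts ∧ T.coe.IsTree ∧ Set.InjOn c T.edgeSet := by
  obtain ⟨T, hTK, hT⟩ :=
    (K.connectedComponentMk r).connected_toSimpleGraph.exists_isTree_le
  let T' : G.Subgraph :=
    { verts := (K.connectedComponentMk r).supp
      Adj := fun u v => ∃ hu hv, T.Adj ⟨u, hu⟩ ⟨v, hv⟩
      adj_sub := fun ⟨_, _, h⟩ => hK (hTK h)
      edge_vert := fun ⟨hu, _, _⟩ => hu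
      symm := ⟨fun _ _ ⟨hu, hv, h⟩ => ⟨hv, hu, h.symm⟩⟩ }
  have hcoe : T'.coe = T := by
    ext u v
    exact ⟨fun ⟨_, _, h⟩ => h, fun h => ⟨u.2, v.2, h⟩⟩
  refine ⟨T', fun s hs => ?_, hcoe ▸ hT, hc.mono ?_⟩
  · exact ConnectedComponent.sound (hS s hs).symm
  · intro e
    induction e with
    | _ u v => exact fun ⟨_, _, h⟩ => hTK h

/-- `X` carries a colouring with colours below `q` in which any three vertices of `X` are joined
by a rainbow subgraph of `G` supported in `X`. -/
def HasRainbowCore {V : Type*} (G : SimpleGraph V) (X : Finset V) (q : ℕ) : Prop :=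
  ∃ c : Sym2 V → ℕ, (∀ e, c e < q) ∧ ∀ a ∈ X, ∀ b ∈ X, ∀ d ∈ X, ∃ (r : V) (K : SimpleGraph V),
    K ≤ G ∧ (∀ u w, K.Adj u w → u ∈ X) ∧ Set.InjOn c K.edgeSet ∧
      K.Reachable r a ∧ K.Reachable r b ∧ K.Reachable r d

/-- A vertex adjacent to a rainbow core can be added at the cost of one colour. -/
theorem HasRainbowCore.insert {V : Type*} [DecidableEq V] {G : SimpleGraph V} {X : Finset V}
    {q : ℕ} (h : HasRainbowCore G X q) {u w : V} (hu : u ∈ X) (hw : w ∉ X) (huw : G.Adj u w) :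
    HasRainbowCore G (insert w X) (q + 1) := by
  classical
  obtain ⟨c, hcq, hc⟩ := h
  let pr : V → V := fun a => if a = w then u else a
  have hpr : ∀ a ∈ Insert.insert w X, pr a ∈ X := by
    intro a ha
    simp only [pr]
    split_ifs with h
    · exact hu
    · exact (Finset.mem_insert.1 ha).resolve_left h
  refine ⟨fun e => if ∀ v ∈ e, v ∈ X then c e else q, fun e => ?_, fun a ha b hb d hd => ?_⟩
  · have := hcq e
    dsimp only
    split_ifs <;> omega
  obtain ⟨r, K, hKG, hKX, hinj, hra, hrb, hrd⟩ :=
    hc _ (hpr a ha) _ (hpr b hb) _ (hpr d hd)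
  have hKmem : ∀ e ∈ K.edgeSet, ∀ v ∈ e, v ∈ X := by
    intro e
    induction e with
    | _ y z =>
      intro he v hv
      rcases Sym2.mem_iff.1 hv with rfl | rfl
      · exact hKX _ _ he
      · exact hKX _ _ he.symm
  have hnew : ¬ ∀ v ∈ s(u, w), v ∈ X := fun h => hw (h w (Sym2.mem_mk_right u w))
  have hedge : ∀ e ∈ (K ⊔ edge u w).edgeSet, e ∈ K.edgeSet ∨ e = s(u, w) := by
    intro e he
    rw [edgeSet_sup, edgeSet_edge_of_ne huw.ne] at he
    exact he
  have hreach : ∀ a, K.Reachable r (pr a) → (K ⊔ edge u w).Reachable r a := by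
    intro a h
    have h' := h.mono (le_sup_left : K ≤ K ⊔ edge u w)
    simp only [pr] at h'
    split_ifs at h' with haw
    · subst haw
      exact h'.trans (Adj.reachable (Or.inr (by simp [edge_adj, huw.ne])))
    · exact h'
  refine ⟨r, K ⊔ edge u w, sup_le hKG ?_, ?_, ?_, hreach a hra, hreach b hrb, hreach d hrd⟩
  · exact (edge_le_iff G).2 (Or.inr huw)
  · rintro y z (h | h)
    · exact Finset.mem_insert_of_mem (hKX _ _ h)
    · rw [edge_adj] at h
      rcases h.1 with ⟨rfl, rfl⟩ | ⟨rfl, rfl⟩ <;> simp [hu]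
  · intro e he f hf hef
    dsimp only at hef
    rcases hedge e he with he | rfl <;> rcases hedge f hf with hf | rfl
    · rw [if_pos (hKmem e he), if_pos (hKmem f hf)] at hef
      exact hinj he hf hef
    · rw [if_pos (hKmem e he), if_neg hnew] at hef
      exact absurd hef (hcq e).ne
    · rw [if_neg hnew, if_pos (hKmem f hf)] at hef
      exact absurd hef.symm (hcq f).ne
    · rfl

/-- In a connected graph, a proper nonempty set of vertices has an edge leaving it. -/
theorem SimpleGraph.Connected.exists_adj_mem_notMem {V : Type*} {G : SimpleGraph V}
    (hG : G.Connected) {X : Finset V} {x y : V} (hx : x ∈ X) (hy : y ∉ X) :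
    ∃ u ∈ X, ∃ w ∉ X, G.Adj u w := by
  obtain ⟨p⟩ := hG.preconnected x y
  obtain ⟨d, -, h₁, h₂⟩ := p.exists_boundary_dart (X : Set V) hx hy
  exact ⟨d.fst, h₁, d.snd, h₂, d.adj⟩

theorem HasRainbowCore.univ {V : Type*} [Fintype V] {G : SimpleGraph V} (hG : G.Connected)
    {X : Finset V} {q : ℕ} (h : HasRainbowCore G X q) (hX : X.Nonempty) :
    HasRainbowCore G Finset.univ (q + (Fintype.card V - X.card)) := by
  classical
  obtain ⟨m, hm⟩ : ∃ m, m = Fintype.card V - X.card := ⟨_, rfl⟩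
  induction m generalizing X q with
  | zero =>
    have : X = Finset.univ := by
      rw [← Finset.card_eq_iff_eq_univ]
      have := X.card_le_univ
      omega
    subst this
    simpa using h
  | succ m ih =>
    obtain ⟨x, hx⟩ := hX
    obtain ⟨y, hy⟩ : ∃ y, y ∉ X := by
      by_contra! hall
      rw [Finset.eq_univ_iff_forall.2 hall, Finset.card_univ] at hm
      omega
    obtain ⟨u, hu, w, hw, huw⟩ := hG.exists_adj_mem_notMem hx hy
    have hcard := Finset.card_insert_of_notMem hw
    have := ih (h.insert hu hw huw) ⟨w, Finset.mem_insert_self w X⟩ (by omega)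
    convert this using 1
    omega

theorem HasRainbowCore.rxk_le {V : Type*} [Fintype V] {G : SimpleGraph V} {q : ℕ}
    (h : HasRainbowCore G Finset.univ q) : rxk G 3 ≤ q := by
  obtain ⟨c, hcq, hc⟩ := h
  refine Nat.sInf_le ⟨fun e => ⟨c e, hcq e⟩, fun S hS => ?_⟩
  classical
  obtain ⟨a, b, d, -, -, -, rfl⟩ := Finset.card_eq_three.1 hS
  obtain ⟨r, K, hKG, -, hinj, ha, hb, hd⟩ :=
    hc a (Finset.mem_univ a) b (Finset.mem_univ b) d (Finset.mem_univ d)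
  refine exists_rainbow_tree hKG (r := r) (fun e he f hf hef => hinj he hf (Fin.mk.inj hef)) ?_
  intro s hs
  simp only [Finset.coe_insert, Finset.coe_singleton, Set.mem_insert_iff,
    Set.mem_singleton_iff] at hs
  rcases hs with rfl | rfl | rfl <;> assumption

/-- A cycle of length `m ≥ 4` is a rainbow core with `m - 2` colours. The cycle is presented as
a path from `z` to `y` closed up through `y, x, v, w, z`. -/
theorem hasRainbowCore_cycle {V : Type*} [DecidableEq V] {G : SimpleGraph V} {x v w z y : V}
    (p : G.Walk z y) (hyx : G.Adj y x) (hxv : G.Adj x v) (hvw : G.Adj v w) (hwz : G.Adj w z)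
    (hxw : x ≠ w) (hx : x ∉ p.support) (hv : v ∉ p.support) (hw : w ∉ p.support) :
    HasRainbowCore G ({x, v, w} ∪ p.support.toFinset) (p.length + 2) := by
  have hz : z ∈ p.support := p.start_mem_support
  have hy : y ∈ p.support := p.end_mem_support
  let c : Sym2 V → ℕ := fun e =>
    if e ∈ p.edges then p.edges.idxOf e
    else if e = s(y, x) ∨ e = s(v, w) then p.length else p.length + 1
  have hcp : ∀ e ∈ p.edges, c e = p.edges.idxOf e := fun e he => if_pos he
  have hclt : ∀ e ∈ p.edges, c e < p.length := fun e he => by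
    rw [hcp e he, ← p.length_edges]
    exact List.idxOf_lt_length_iff.2 he
  have hsupp : ∀ {a b : V}, s(a, b) ∈ p.edges → a ∈ p.support ∧ b ∈ p.support := fun h =>
    ⟨p.fst_mem_support_of_mem_edges h, p.snd_mem_support_of_mem_edges h⟩
  have hyx' : c s(y, x) = p.length := by
    simp only [c]
    rw [if_neg fun h => hx (hsupp h).2]
    simp
  have hvw' : c s(v, w) = p.length := by
    simp only [c]
    rw [if_neg fun h => hv (hsupp h).1]
    simp
  have hxv' : c s(x, v) = p.length + 1 := by
    simp only [c]
    rw [if_neg fun h => hx (hsupp h).1, if_neg]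
    have := hxv.ne
    have := hvw.ne
    grind
  have hwz' : c s(w, z) = p.length + 1 := by
    simp only [c]
    rw [if_neg fun h => hw (hsupp h).1, if_neg]
    have := hxv.ne
    have := hvw.ne
    grind
  -- adding to the path one edge of either extra colour leaves it rainbow
  have key : ∀ e f : Sym2 V, e ∈ G.edgeSet → f ∈ G.edgeSet → c e = p.length →
      c f = p.length + 1 → (∀ t ∈ e, t ∈ ({x, v, w} : Finset V) ∪ p.support.toFinset) →
      (∀ t ∈ f, t ∈ ({x, v, w} : Finset V) ∪ p.support.toFinset) →
      ∃ K : SimpleGraph V, K ≤ G ∧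
        (∀ a b, K.Adj a b → a ∈ ({x, v, w} : Finset V) ∪ p.support.toFinset) ∧
        Set.InjOn c K.edgeSet ∧ (∀ a ∈ p.support, K.Reachable z a) ∧
        ∀ a b, a ≠ b → s(a, b) = e ∨ s(a, b) = f → K.Reachable a b := by
    intro e f he hf hce hcf hme hmf
    have hE : ∀ g ∈ (fromEdgeSet ({g | g ∈ p.edges} ∪ {e, f})).edgeSet,
        g ∈ p.edges ∨ g = e ∨ g = f := by
      intro g hg
      rw [edgeSet_fromEdgeSet] at hg
      exact hg.1
    refine ⟨fromEdgeSet ({g | g ∈ p.edges} ∪ {e, f}), ?_, ?_, ?_, ?_, ?_⟩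
    · rw [← edgeSet_subset_edgeSet]
      intro g hg
      rcases hE g hg with h | rfl | rfl
      · exact p.edges_subset_edgeSet h
      · exact he
      · exact hf
    · intro a b hab
      rcases hE s(a, b) hab with h | h | h
      · simp [(hsupp h).1]
      · exact hme a (h ▸ Sym2.mem_mk_left a b)
      · exact hmf a (h ▸ Sym2.mem_mk_left a b)
    · intro g hg g' hg' hgg
      rcases hE g hg with h | rfl | rfl <;> rcases hE g' hg' with h' | rfl | rfl
      · rw [hcp g h, hcp g' h'] at hgg
        exact (List.idxOf_inj h).1 hgg
      all_goals first
        | rfl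
        | (exfalso; grind)
    · intro a ha
      have hsub : ∀ g ∈ (p.takeUntil a ha).edges,
          g ∈ (fromEdgeSet ({g | g ∈ p.edges} ∪ {e, f})).edgeSet := by
        intro g hg
        rw [edgeSet_fromEdgeSet]
        exact ⟨Or.inl (p.edges_takeUntil_subset_edges ha hg),
          G.not_isDiag_of_mem_edgeSet ((p.takeUntil a ha).edges_subset_edgeSet hg)⟩
      exact ((p.takeUntil a ha).transfer _ hsub).reachable
    · intro a b hab h
      refine Adj.reachable ?_
      rw [fromEdgeSet_adj]
      exact ⟨Or.inr h, hab⟩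
  refine ⟨c, fun e => ?_, fun a ha b hb d hd => ?_⟩
  · by_cases h : e ∈ p.edges
    · have := hclt e h
      omega
    · simp only [c]
      rw [if_neg h]
      split_ifs <;> omega
  simp only [Finset.mem_union, Finset.mem_insert, Finset.mem_singleton, List.mem_toFinset]
    at ha hb hd
  by_cases h₁ : a ≠ x ∧ b ≠ x ∧ d ≠ x
  · obtain ⟨K, hKG, hKX, hinj, hp, hef⟩ := key s(v, w) s(w, z) hvw hwz hvw' hwz'
      (by simp) (by simp)
    have hzw : K.Reachable z w := (hef w z hwz.ne (Or.inr rfl)).symm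
    have hzv : K.Reachable z v := hzw.trans (hef v w hvw.ne (Or.inl rfl)).symm
    have hall : ∀ t, ((t = x ∨ t = v ∨ t = w) ∨ t ∈ p.support) → t ≠ x → K.Reachable z t := by
      rintro t ((rfl | rfl | rfl) | h) ht
      all_goals first | assumption | exact absurd rfl ht | exact hp t h
    exact ⟨z, K, hKG, hKX, hinj, hall a ha h₁.1, hall b hb h₁.2.1, hall d hd h₁.2.2⟩
  by_cases h₂ : a ≠ v ∧ b ≠ v ∧ d ≠ v
  · obtain ⟨K, hKG, hKX, hinj, hp, hef⟩ := key s(y, x) s(w, z) hyx hwz hyx' hwz'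
      (by simp) (by simp)
    have hzw : K.Reachable z w := (hef w z hwz.ne (Or.inr rfl)).symm
    have hzx : K.Reachable z x := (hp y hy).trans (hef y x hyx.ne (Or.inl rfl))
    have hall : ∀ t, ((t = x ∨ t = v ∨ t = w) ∨ t ∈ p.support) → t ≠ v → K.Reachable z t := by
      rintro t ((rfl | rfl | rfl) | h) ht
      all_goals first | assumption | exact absurd rfl ht | exact hp t h
    exact ⟨z, K, hKG, hKX, hinj, hall a ha h₂.1, hall b hb h₂.2.1, hall d hd h₂.2.2⟩
  by_cases h₃ : a ≠ w ∧ b ≠ w ∧ d ≠ w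
  · obtain ⟨K, hKG, hKX, hinj, hp, hef⟩ := key s(y, x) s(x, v) hyx hxv hyx' hxv'
      (by simp) (by simp)
    have hzx : K.Reachable z x := (hp y hy).trans (hef y x hyx.ne (Or.inl rfl))
    have hzv : K.Reachable z v := hzx.trans (hef x v hxv.ne (Or.inr rfl))
    have hall : ∀ t, ((t = x ∨ t = v ∨ t = w) ∨ t ∈ p.support) → t ≠ w → K.Reachable z t := by
      rintro t ((rfl | rfl | rfl) | h) ht
      all_goals first | assumption | exact absurd rfl ht | exact hp t h
    exact ⟨z, K, hKG, hKX, hinj, hall a ha h₃.1, hall b hb h₃.2.1, hall d hd h₃.2.2⟩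
  · obtain ⟨K, hKG, hKX, hinj, hp, hef⟩ := key s(v, w) s(x, v) hvw hxv hvw' hxv'
      (by simp) (by simp)
    have hvw'' : K.Reachable v w := hef v w hvw.ne (Or.inl rfl)
    have hvx : K.Reachable v x := (hef x v hxv.ne (Or.inr rfl)).symm
    have hvv : K.Reachable v v := Reachable.refl v
    have hall : ∀ t, (t = x ∨ t = v ∨ t = w) → K.Reachable v t := by
      rintro t (rfl | rfl | rfl) <;> assumption
    obtain ⟨ha, hb, hd⟩ := eq_or_eq_or_eq_of_covers hxv.ne hxw hvw.ne h₁ h₂ h₃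
    exact ⟨v, K, hKG, hKX, hinj, hall a ha, hall b hb, hall d hd⟩

/-- Two triangles sharing exactly one vertex form a rainbow core with three colours. -/
theorem hasRainbowCore_bowtie {V : Type*} [DecidableEq V] {G : SimpleGraph V} {v a b c d : V}
    (hva : G.Adj v a) (hvb : G.Adj v b) (hab : G.Adj a b)
    (hvc : G.Adj v c) (hvd : G.Adj v d) (hcd : G.Adj c d)
    (hac : a ≠ c) (had : a ≠ d) (hbc : b ≠ c) (hbd : b ≠ d) :
    HasRainbowCore G {v, a, b, c, d} 3 := by
  have := hva.ne
  have := hvb.ne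
  have := hab.ne
  have := hvc.ne
  have := hvd.ne
  have := hcd.ne
  let col : Sym2 V → ℕ := fun e =>
    if e = s(v, a) ∨ e = s(v, c) then 0 else if e = s(v, b) ∨ e = s(v, d) then 1 else 2
  -- a rainbow tree formed by a triangle path `v`, `s`, `t` and a pendant edge `v`, `u`
  have key : ∀ u s t : V, G.Adj v u → G.Adj v s → G.Adj s t →
      Set.InjOn col {s(v, u), s(v, s), s(s, t)} →
      u ∈ ({v, a, b, c, d} : Finset V) → s ∈ ({v, a, b, c, d} : Finset V) →
      t ∈ ({v, a, b, c, d} : Finset V) →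
      ∃ K : SimpleGraph V, K ≤ G ∧ (∀ i j, K.Adj i j → i ∈ ({v, a, b, c, d} : Finset V)) ∧
        Set.InjOn col K.edgeSet ∧ K.Reachable v v ∧ K.Reachable v u ∧ K.Reachable v s ∧
          K.Reachable v t := by
    intro u s t hu hs hst hinj mu ms mt
    have hvs : (fromEdgeSet {s(v, u), s(v, s), s(s, t)}).Adj v s := by
      simp [hs.ne]
    refine ⟨fromEdgeSet {s(v, u), s(v, s), s(s, t)}, ?_, ?_, ?_, Reachable.refl v, ?_,
      hvs.reachable, hvs.reachable.trans (Adj.reachable ?_)⟩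
    · rw [← edgeSet_subset_edgeSet, edgeSet_fromEdgeSet]
      rintro e ⟨rfl | rfl | rfl, -⟩ <;> assumption
    · intro i j hij
      rw [fromEdgeSet_adj] at hij
      have hv : v ∈ ({v, a, b, c, d} : Finset V) := Finset.mem_insert_self _ _
      grind
    · refine hinj.mono ?_
      rw [edgeSet_fromEdgeSet]
      exact Set.sdiff_subset
    · exact Adj.reachable (by simp [hu.ne])
    · simp [hst.ne]
  refine ⟨col, fun e => ?_, fun i hi j hj k hk => ?_⟩
  · simp only [col]
    split_ifs <;> omega
  have c1 : col s(v, a) = 0 := by simp [col]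
  have c2 : col s(v, c) = 0 := by simp [col]
  have c3 : col s(v, b) = 1 := by
    simp [col, hab.ne', hbc, hva.ne, hvc.ne]
  have c4 : col s(v, d) = 1 := by
    simp [col, had.symm, hcd.ne', hva.ne, hvc.ne]
  have c5 : col s(a, b) = 2 := by
    simp [col, hva.ne', hvb.ne', hab.ne, hac, had]
  have c6 : col s(c, d) = 2 := by
    simp [col, hvc.ne', hvd.ne', hcd.ne, hac.symm, hbc.symm]
  have c5' : col s(b, a) = 2 := Sym2.eq_swap ▸ c5
  have c6' : col s(d, c) = 2 := Sym2.eq_swap ▸ c6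
  have inj : ∀ e f g, col e ≠ col f → col e ≠ col g → col f ≠ col g →
      Set.InjOn col {e, f, g} := by
    intro e f g h₁ h₂ h₃ x hx y hy hxy
    simp only [Set.mem_insert_iff, Set.mem_singleton_iff] at hx hy
    grind
  simp only [Finset.mem_insert, Finset.mem_singleton] at hi hj hk
  by_cases h₁ : i ≠ a ∧ j ≠ a ∧ k ≠ a
  · obtain ⟨K, hKG, hKX, hinj, r₀, r₁, r₂, r₃⟩ := key b c d hvb hvc hcd
      (inj _ _ _ (by omega) (by omega) (by omega)) (by simp) (by simp) (by simp)
    have hall : ∀ t, (t = v ∨ t = a ∨ t = b ∨ t = c ∨ t = d) → t ≠ a → K.Reachable v t := by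
      rintro t (rfl | rfl | rfl | rfl | rfl) ht
      all_goals first | assumption | exact absurd rfl ht
    exact ⟨v, K, hKG, hKX, hinj, hall i hi h₁.1, hall j hj h₁.2.1, hall k hk h₁.2.2⟩
  by_cases h₂ : i ≠ b ∧ j ≠ b ∧ k ≠ b
  · obtain ⟨K, hKG, hKX, hinj, r₀, r₁, r₂, r₃⟩ := key a d c hva hvd hcd.symm
      (inj _ _ _ (by omega) (by omega) (by omega)) (by simp) (by simp) (by simp)
    have hall : ∀ t, (t = v ∨ t = a ∨ t = b ∨ t = c ∨ t = d) → t ≠ b → K.Reachable v t := by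
      rintro t (rfl | rfl | rfl | rfl | rfl) ht
      all_goals first | assumption | exact absurd rfl ht
    exact ⟨v, K, hKG, hKX, hinj, hall i hi h₂.1, hall j hj h₂.2.1, hall k hk h₂.2.2⟩
  by_cases h₃ : i ≠ c ∧ j ≠ c ∧ k ≠ c
  · obtain ⟨K, hKG, hKX, hinj, r₀, r₁, r₂, r₃⟩ := key d a b hvd hva hab
      (inj _ _ _ (by omega) (by omega) (by omega)) (by simp) (by simp) (by simp)
    have hall : ∀ t, (t = v ∨ t = a ∨ t = b ∨ t = c ∨ t = d) → t ≠ c → K.Reachable v t := by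
      rintro t (rfl | rfl | rfl | rfl | rfl) ht
      all_goals first | assumption | exact absurd rfl ht
    exact ⟨v, K, hKG, hKX, hinj, hall i hi h₃.1, hall j hj h₃.2.1, hall k hk h₃.2.2⟩
  · obtain ⟨hi, hj, hk⟩ := eq_or_eq_or_eq_of_covers hab.ne hac hbc h₁ h₂ h₃
    obtain ⟨K, hKG, hKX, hinj, r₀, r₁, r₂, r₃⟩ := key c b a hvc hvb hab.symm
      (inj _ _ _ (by omega) (by omega) (by omega)) (by simp) (by simp) (by simp)
    have hall : ∀ t, (t = a ∨ t = b ∨ t = c) → K.Reachable v t := by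
      rintro t (rfl | rfl | rfl) <;> assumption
    exact ⟨v, K, hKG, hKX, hinj, hall i hi, hall j hj, hall k hk⟩

/-- A cycle of length at least four yields a rainbow core missing two colours. -/
theorem SimpleGraph.Walk.IsCycle.exists_hasRainbowCore {V : Type*} {G : SimpleGraph V} {y : V}
    {q : G.Walk y y} (hq : q.IsCycle) (hlen : 4 ≤ q.length) :
    ∃ X : Finset V, 2 ≤ X.card ∧ HasRainbowCore G X (X.card - 2) := by
  classical
  match q, hq, hlen with
  | .cons (v := x) hyx (.cons (v := v) hxv (.cons (v := w) hvw (.cons hwz p))), hq, _ =>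
    have hnd := hq.support_nodup
    simp only [Walk.support_cons, List.tail_cons, List.nodup_cons, List.mem_cons, not_or] at hnd
    obtain ⟨⟨hxv', hxw, hx⟩, ⟨hvw', hv⟩, hw, hp⟩ := hnd
    have hcard : (({x, v, w} : Finset V) ∪ p.support.toFinset).card = p.length + 4 := by
      rw [Finset.card_union_of_disjoint, List.toFinset_card_of_nodup hp, Walk.length_support,
        Finset.card_eq_three.2 ⟨x, v, w, hxv', hxw, hvw', rfl⟩]
      · omega
      · simp [hx, hv, hw]
    refine ⟨{x, v, w} ∪ p.support.toFinset, by omega, ?_⟩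
    rw [hcard]
    exact hasRainbowCore_cycle p hyx hxv hvw hwz hxw hx hv hw

/-- A connected bridgeless graph with at least four vertices has a rainbow core missing two
colours. -/
theorem exists_hasRainbowCore {V : Type*} [Fintype V] {G : SimpleGraph V} (hG : G.Connected)
    (hbridge : ∀ e : Sym2 V, ¬ G.IsBridge e) (hn : 4 ≤ Fintype.card V) :
    ∃ X : Finset V, 2 ≤ X.card ∧ HasRainbowCore G X (X.card - 2) := by
  classical
  by_contra hno
  have htri : ∀ u w, G.Adj u w → ∃ t, G.Adj u t ∧ G.Adj w t := by
    intro u w huw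
    have hb := hbridge s(u, w)
    rw [isBridge_iff_forall_cycle_notMem huw] at hb
    push Not at hb
    obtain ⟨y, q, hq, hmem⟩ := hb
    have hlen : q.length = 3 := by
      have h₃ := hq.three_le_length
      by_contra hne
      exact hno (hq.exists_hasRainbowCore (by omega))
    match q, hq, hlen, hmem with
    | .cons h₁ (.cons h₂ (.cons h₃ .nil)), _, _, hmem =>
      simp only [Walk.edges_cons, Walk.edges_nil, List.mem_cons, List.not_mem_nil, or_false,
        Sym2.eq_iff] at hmem
      rcases hmem with (⟨rfl, rfl⟩ | ⟨rfl, rfl⟩) | (⟨rfl, rfl⟩ | ⟨rfl, rfl⟩) |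
        (⟨rfl, rfl⟩ | ⟨rfl, rfl⟩)
      · exact ⟨_, h₃.symm, h₂⟩
      · exact ⟨_, h₂, h₃.symm⟩
      · exact ⟨_, h₁.symm, h₃⟩
      · exact ⟨_, h₃, h₁.symm⟩
      · exact ⟨_, h₂.symm, h₁⟩
      · exact ⟨_, h₁, h₂.symm⟩
  have hsquare : ∀ a b c d, G.Adj a b → G.Adj b c → G.Adj c d → G.Adj d a → a ≠ c → b ≠ d →
      False := by
    intro a b c d hab hbc hcd hda hac hbd
    refine hno ?_
    have hcyc : (Walk.cons hab (.cons hbc (.cons hcd (.cons hda .nil)))).IsCycle := by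
      have := hab.ne
      have := hbc.ne
      have := hcd.ne
      have := hda.ne
      rw [Walk.cons_isCycle_iff]
      simp only [Walk.isPath_def, Walk.support_cons, Walk.support_nil, Walk.edges_cons,
        Walk.edges_nil, List.nodup_cons, List.mem_cons]
      grind
    exact hcyc.exists_hasRainbowCore (by simp)
  have hfinish : ∀ v a b c, G.Adj v a → G.Adj v b → G.Adj a b → G.Adj v c → a ≠ c → b ≠ c →
      False := by
    intro v a b c hva hvb hab hvc hac hbc
    obtain ⟨d, hvd, hcd⟩ := htri v c hvc
    have had : a ≠ d := by
      rintro rfl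
      exact hsquare v b a c hvb hab.symm hcd.symm hvc.symm hva.ne hbc
    have hbd : b ≠ d := by
      rintro rfl
      exact hsquare v a b c hva hab hcd.symm hvc.symm hvb.ne hac
    have hcard : ({v, a, b, c, d} : Finset V).card = 5 := by
      have := hva.ne
      have := hvb.ne
      have := hab.ne
      have := hvc.ne
      have := hvd.ne
      have := hcd.ne
      repeat rw [Finset.card_insert_of_notMem (by grind)]
      simp
    refine hno ⟨{v, a, b, c, d}, by omega, ?_⟩
    rw [hcard]
    exact hasRainbowCore_bowtie hva hvb hab hvc hvd hcd hac had hbc hbd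
  have : Nontrivial V := Fintype.one_lt_card_iff_nontrivial.1 (by omega)
  obtain ⟨v⟩ := hG.nonempty
  obtain ⟨a, hva⟩ := hG.preconnected.exists_adj_of_nontrivial v
  obtain ⟨b, hvb, hab⟩ := htri v a hva
  obtain ⟨t, ht⟩ : ∃ t, t ∉ ({v, a, b} : Finset V) := by
    by_contra! hall
    have h₁ := Finset.card_le_three (a := v) (b := a) (c := b)
    rw [Finset.eq_univ_iff_forall.2 hall, Finset.card_univ] at h₁
    omega
  obtain ⟨u, hu, w, hw, huw⟩ := hG.exists_adj_mem_notMem (Finset.mem_insert_self v {a, b}) ht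
  simp only [Finset.mem_insert, Finset.mem_singleton, not_or] at hu hw
  obtain ⟨hwv, hwa, hwb⟩ := hw
  rcases hu with rfl | rfl | rfl
  · exact hfinish u a b w hva hvb hab huw (Ne.symm hwa) (Ne.symm hwb)
  · exact hfinish u v b w hva.symm hab hvb huw (Ne.symm hwv) (Ne.symm hwb)
  · exact hfinish u v a w hvb.symm hab.symm hva huw (Ne.symm hwv) (Ne.symm hwa)

theorem stmt_13 {V : Type*} [Fintype V] (G : SimpleGraph V) (hG : G.Connected)
    (hbridge : ∀ e : Sym2 V, ¬ G.IsBridge e) (hn : 4 ≤ Fintype.card V) :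
    rxk G 3 ≤ Fintype.card V - 2 := by
  obtain ⟨X, hX, hcore⟩ := exists_hasRainbowCore hG hbridge hn
  have hle := (hcore.univ hG (Finset.card_pos.1 (by omega))).rxk_le
  have := X.card_le_univ
  omega
end
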